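/- Let N ≥ 1, m > 1, q ∈ (0,1) and σ ≥ 2(1−q)/(m−1). Let a, A, R > 0 satisfy a > σ/(1−q) and A^{m−q} R^{a(m−q)−σ−2} ≤ 1/(am(am+N−2)). Let u_0 ∈ L^∞(ℝ^N) be non-negative with u_0(x) ≤ A|x|^a for a.e. x ∈ B(0,R) and ‖u_0‖_∞ ≤ A R^a. Then every non-negative weak solution u of ∂_t u = Δ(u^m) − |x|^σ u^q with u(0) = u_0 satisfies u(t,x) ≤ A|x|^a for a.e. (t,x) ∈ (0,∞)×B(0,R). -/

import Mathlib

open MeasureTheory Set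

noncomputable section

/-- A non-negative weak solution of `∂ₜ u = Δ(uᵐ) − w(x) u^q` on `(0,∞)×ℝᴺ`
with initial condition `u₀`, in the sense of Definition 1.1 of the paper:
`u` is a bounded non-negative measurable function, and there is a measurable
vector field `g` (the weak spatial gradient of `uᵐ`) which is locally square
integrable on `(0,T)×ℝᴺ`, satisfies the weak derivative identity against test
functions in `C_c^1((0,T)×ℝᴺ)`, and satisfies the weak formulation of the
equation against test functions in `C_c^1([0,T)×ℝᴺ)`. -/
def IsWeakSolution (N : ℕ) (m q : ℝ) (w : EuclideanSpace ℝ (Fin N) → ℝ)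
    (u0 : EuclideanSpace ℝ (Fin N) → ℝ)
    (u : ℝ → EuclideanSpace ℝ (Fin N) → ℝ) : Prop :=
  Measurable (Function.uncurry u) ∧
  (∀ t x, 0 ≤ u t x) ∧
  (∃ C : ℝ, ∀ t x, u t x ≤ C) ∧
  ∃ g : ℝ → EuclideanSpace ℝ (Fin N) → EuclideanSpace ℝ (Fin N),
    Measurable (Function.uncurry g) ∧
    ∀ T > (0:ℝ),
      (∀ K : Set (EuclideanSpace ℝ (Fin N)), IsCompact K →
        ∫⁻ s in Ioo (0:ℝ) T, ∫⁻ x in K, ENNReal.ofReal (‖g s x‖ ^ 2) < ⊤) ∧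
      (∀ ζ : ℝ × EuclideanSpace ℝ (Fin N) → ℝ, ContDiff ℝ 1 ζ →
        HasCompactSupport ζ → (∀ s x, s ∉ Ioo (0:ℝ) T → ζ (s, x) = 0) →
        ∀ i : Fin N,
          (∫ s in Ioo (0:ℝ) T, ∫ x,
              (u s x) ^ m * fderiv ℝ ζ (s, x) (0, EuclideanSpace.single i 1))
            = - ∫ s in Ioo (0:ℝ) T, ∫ x, g s x i * ζ (s, x)) ∧
      (∀ ζ : ℝ × EuclideanSpace ℝ (Fin N) → ℝ, ContDiff ℝ 1 ζ →
        HasCompactSupport ζ → (∀ s x, T ≤ s → ζ (s, x) = 0) →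
        ∫ s in Ioo (0:ℝ) T, ∫ x,
            ((u0 x - u s x) * fderiv ℝ ζ (s, x) (1, 0)
              + fderiv ℝ ζ (s, x) (0, g s x)
              + w x * (u s x) ^ q * ζ (s, x)) = 0)

/-- `u₀` is a non-negative function in `L^∞(ℝᴺ)`. -/
def IsBddNonneg (N : ℕ) (u0 : EuclideanSpace ℝ (Fin N) → ℝ) : Prop :=
  Measurable u0 ∧ (∀ x, 0 ≤ u0 x) ∧ ∃ C : ℝ, ∀ x, u0 x ≤ C

/-- The solution `u` vanishes in finite time. -/
def VanishesInFiniteTime (N : ℕ) (u : ℝ → EuclideanSpace ℝ (Fin N) → ℝ) : Prop :=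
  ∃ Te : ℝ, 0 < Te ∧ ∀ᵐ t : ℝ, Te ≤ t → ∀ᵐ x : EuclideanSpace ℝ (Fin N), u t x = 0

/-- The support of `u(t)` is contained in `B(0,R)` for a.e. `t > 0`. -/
def SupportLocalized (N : ℕ) (R : ℝ) (u : ℝ → EuclideanSpace ℝ (Fin N) → ℝ) : Prop :=
  ∀ᵐ t : ℝ, 0 < t → ∀ᵐ x : EuclideanSpace ℝ (Fin N), R ≤ ‖x‖ → u t x = 0


open Filter Topology
open scoped ENNReal Convolution

lemma transl_cont {X F : Type*} [NormedAddCommGroup X] [NormedSpace ℝ X] [FiniteDimensional ℝ X]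
    [MeasurableSpace X] [BorelSpace X] (μ : Measure X) [μ.IsAddHaarMeasure]
    [NormedAddCommGroup F] (G : X → F) (hG : MemLp G 2 μ) (ε : ℝ≥0∞) (hε : 0 < ε) :
    ∃ δ > 0, ∀ y : X, ‖y‖ < δ → ∫⁻ z, ‖G (z - y) - G z‖ₑ ^ 2 ∂μ ≤ ε := by
  have : Fact ((1:ℝ≥0∞) ≤ 2) := ⟨by norm_num⟩
  let g : X → C(X, X) := fun y => ⟨fun z => z - y, by fun_prop⟩
  have hg : Continuous g := by
    apply ContinuousMap.continuous_of_continuous_uncurry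
    simp only [g]
    show Continuous (fun p : X × X => p.2 - p.1)
    fun_prop
  have hgm : ∀ y, MeasurePreserving (g y) μ μ := fun y => measurePreserving_sub_right μ y
  have hc : Continuous fun y => Lp.compMeasurePreserving (g y) (hgm y) (hG.toLp G) :=
    (continuous_const : Continuous fun _ : X => hG.toLp G).compMeasurePreservingLp hg hgm (by norm_num)
  have hc0 := hc.tendsto 0
  have h0 : Lp.compMeasurePreserving (g 0) (hgm 0) (hG.toLp G) = hG.toLp G := by
    ext1
    refine (Lp.coeFn_compMeasurePreserving _ _).trans ?_
    filter_upwards with z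
    simp [g]
  rw [h0] at hc0
  rw [tendsto_iff_edist_tendsto_0] at hc0
  have h1 : Tendsto (fun y => (edist (Lp.compMeasurePreserving (g y) (hgm y) (hG.toLp G)) (hG.toLp G)) ^ 2) (𝓝 0) (𝓝 0) := by
    have := ENNReal.Tendsto.pow (n := 2) hc0
    simpa using this
  have h2 := h1.eventually (eventually_lt_nhds hε)
  rw [Metric.eventually_nhds_iff] at h2
  obtain ⟨δ, hδ, h⟩ := h2
  refine ⟨δ, hδ, fun y hy => ?_⟩
  have := (h (y := y) (by simpa using hy)).le
  refine le_trans (le_of_eq ?_) this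
  rw [Lp.toLp_compMeasurePreserving, Lp.edist_toLp_toLp, eLpNorm_eq_lintegral_rpow_enorm_toReal (by norm_num) (by norm_num)]
  simp only [ENNReal.toReal_ofNat, one_div, ENNReal.rpow_ofNat]
  rw [← ENNReal.rpow_natCast, ← ENNReal.rpow_mul]
  simp [g]

lemma moll_L2 {X F : Type*} [NormedAddCommGroup X] [NormedSpace ℝ X] [FiniteDimensional ℝ X]
    [MeasurableSpace X] [BorelSpace X] (μ : Measure X) [μ.IsAddHaarMeasure]
    [NormedAddCommGroup F] [NormedSpace ℝ F] [CompleteSpace F]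
    (G : X → F) (hG : MemLp G 2 μ)
    (ρ : ContDiffBump (0 : X)) (ε : ℝ≥0∞) 
    (h : ∀ y : X, ‖y‖ < ρ.rOut → ∫⁻ z, ‖G (z - y) - G z‖ₑ ^ 2 ∂μ ≤ ε) :
    ∫⁻ z, ‖(∫ y, ρ.normed μ y • G (z - y) ∂μ) - G z‖ₑ ^ 2 ∂μ ≤ ε := by
  have hint : LocallyIntegrable G μ := hG.locallyIntegrable (by norm_num)
  have hρi : ∀ z, Integrable (fun y => ρ.normed μ y • G (z - y)) μ := fun z =>
    (ρ.hasCompactSupport_normed.convolutionExists_left (ContinuousLinearMap.lsmul ℝ ℝ)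
      ρ.continuous_normed hint z)
  set κ : X → ℝ≥0∞ := fun y => ENNReal.ofReal (ρ.normed μ y) with hκ
  have hκm : Measurable κ := (ρ.continuous_normed.measurable).ennreal_ofReal
  have hκ1 : ∫⁻ y, κ y ∂μ = 1 := by
    rw [← ofReal_integral_eq_lintegral_ofReal ρ.integrable_normed
      (ae_of_all _ ρ.nonneg_normed), ρ.integral_normed, ENNReal.ofReal_one]
  have key : ∀ z, ‖(∫ y, ρ.normed μ y • G (z - y) ∂μ) - G z‖ₑ ^ 2
      ≤ ∫⁻ y, κ y * ‖G (z - y) - G z‖ₑ ^ 2 ∂μ := by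
    intro z
    have e1 : (∫ y, ρ.normed μ y • G (z - y) ∂μ) - G z
        = ∫ y, ρ.normed μ y • (G (z - y) - G z) ∂μ := by
      simp_rw [smul_sub]
      rw [integral_sub (hρi z) (ρ.integrable_normed.smul_const _), ρ.integral_normed_smul]
    have m1 : AEMeasurable (fun y => ‖G (z - y) - G z‖ₑ) μ := by
      have := hG.1.comp_quasiMeasurePreserving (quasiMeasurePreserving_sub_left μ z)
      exact (this.sub aestronglyMeasurable_const).enorm
    rw [e1]
    calc ‖∫ y, ρ.normed μ y • (G (z - y) - G z) ∂μ‖ₑ ^ 2 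
        ≤ (∫⁻ y, κ y * ‖G (z - y) - G z‖ₑ ∂μ) ^ 2 := by
          gcongr
          refine (enorm_integral_le_lintegral_enorm _).trans (le_of_eq ?_)
          congr 1; ext y
          rw [enorm_smul, Real.enorm_eq_ofReal (ρ.nonneg_normed y)]
      _ ≤ _ := by
          have hh := ENNReal.lintegral_mul_le_Lp_mul_Lq μ (Real.HolderConjugate.two_two)
            (f := fun y => κ y ^ (1/2:ℝ)) (g := fun y => κ y ^ (1/2:ℝ) * ‖G (z - y) - G z‖ₑ)
            (by fun_prop) (by fun_prop)
          have e2 : ∀ a : ℝ≥0∞, (a ^ (1/2:ℝ)) ^ (2:ℝ) = a := by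
            intro a; rw [← ENNReal.rpow_mul]; norm_num
          have e3 : ∀ a : ℝ≥0∞, (a ^ (1/2:ℝ)) * a ^ (1/2:ℝ) = a := by
            intro a; rw [← ENNReal.rpow_add_of_nonneg _ _ (by norm_num) (by norm_num)]; norm_num
          simp only [Pi.mul_apply, ← mul_assoc, e3, ENNReal.mul_rpow_of_nonneg _ _ (zero_le_two), e2, hκ1, ENNReal.one_rpow, one_mul] at hh
          calc _ ≤ ((∫⁻ y, κ y * ‖G (z - y) - G z‖ₑ ^ (2:ℝ) ∂μ) ^ (1/2:ℝ)) ^ 2 := by gcongr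
            _ = _ := by 
              rw [← ENNReal.rpow_natCast, ← ENNReal.rpow_mul]; norm_num
  calc _ ≤ ∫⁻ z, ∫⁻ y, κ y * ‖G (z - y) - G z‖ₑ ^ 2 ∂μ ∂μ := lintegral_mono key
    _ = ∫⁻ y, ∫⁻ z, κ y * ‖G (z - y) - G z‖ₑ ^ 2 ∂μ ∂μ := by
      refine lintegral_lintegral_swap ?_
      have a1 : AEStronglyMeasurable (fun p : X × X => G (p.1 - p.2)) (μ.prod μ) :=
        hG.1.comp_quasiMeasurePreserving (quasiMeasurePreserving_sub_of_right_invariant μ μ)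
      have a2 : AEStronglyMeasurable (fun p : X × X => G p.1) (μ.prod μ) := hG.1.comp_fst
      have := (a1.sub a2).enorm.pow_const 2
      exact (hκm.comp measurable_snd).aemeasurable.mul this
    _ ≤ ∫⁻ y, κ y * ε ∂μ := by
      refine lintegral_mono fun y => ?_
      by_cases hy : ‖y‖ < ρ.rOut
      · dsimp only
        rw [lintegral_const_mul' _ _ (by simp [hκ])]
        gcongr
        exact h y hy
      · have : κ y = 0 := by
          have : y ∉ Function.support (ρ.normed μ) := by
            rw [ρ.support_normed_eq]; simpa using hy
          simp [hκ, Function.notMem_support.1 this]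
        simp [this]
    _ = ε := by rw [lintegral_mul_const _ hκm, hκ1, one_mul]

abbrev EN (N : ℕ) := EuclideanSpace ℝ (Fin N)

instance instHaarX (N : ℕ) : (volume : Measure (ℝ × EN N)).IsAddHaarMeasure :=
  inferInstanceAs ((volume : Measure ℝ).prod (volume : Measure (EN N))).IsAddHaarMeasure

set_option maxHeartbeats 1000000 in
lemma mollify (N : ℕ) (r M : ℝ) (v : ℝ × EN N → ℝ) (hv : Measurable v)
    (hv0 : ∀ z, 0 ≤ v z) (hvM : ∀ z, v z ≤ M)
    (g : ℝ × EN N → EN N)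
    (hg2 : MemLp (indicator (univ ×ˢ Metric.closedBall (0 : EN N) (r+1)) g) 2 volume)
    (hw : ∀ ζ : ℝ × EN N → ℝ, ContDiff ℝ 1 ζ → HasCompactSupport ζ → ∀ i : Fin N,
      ∫ z, v z * fderiv ℝ ζ z (0, EuclideanSpace.single i 1) = - ∫ z, g z i * ζ z) :
    ∃ (vn : ℕ → ℝ × EN N → ℝ) (gn : ℕ → ℝ × EN N → EN N),
      (∀ n, ContDiff ℝ 1 (vn n)) ∧ (∀ n z, 0 ≤ vn n z ∧ vn n z ≤ M) ∧
      (∀ᵐ z, Tendsto (fun n => vn n z) atTop (𝓝 (v z))) ∧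
      (∀ n, Continuous (gn n)) ∧
      (∀ n z, ‖z.2‖ ≤ r → ∀ e : EN N, fderiv ℝ (vn n) z (0, e) = inner ℝ (gn n z) e) ∧
      Tendsto (fun n => ∫⁻ z, ‖gn n z -
        indicator (univ ×ˢ Metric.closedBall (0 : EN N) (r+1)) g z‖ₑ ^ 2) atTop (𝓝 0) := by
  set G := indicator (univ ×ˢ Metric.closedBall (0 : EN N) (r+1)) g with hG
  have hM : 0 ≤ M := (hv0 0).trans (hvM 0)
  have hGl : LocallyIntegrable G volume := hg2.locallyIntegrable (by norm_num)
  have hvl : LocallyIntegrable v volume := by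
    have : MemLp v ∞ volume := memLp_top_of_bound hv.aestronglyMeasurable M
      (ae_of_all _ fun z => by rw [Real.norm_of_nonneg (hv0 z)]; exact hvM z)
    exact this.locallyIntegrable le_top
  let ρ : ℕ → ContDiffBump (0 : ℝ × EN N) := fun n =>
    ⟨1 / (2 * ((n:ℝ) + 2)), 1 / ((n:ℝ) + 2), by positivity, by
      apply one_div_lt_one_div_of_lt <;> nlinarith [(n.cast_nonneg : (0:ℝ) ≤ n)]⟩
  have hρ0 : Tendsto (fun n => (ρ n).rOut) atTop (𝓝 0) := by
    have := tendsto_one_div_add_atTop_nhds_zero_nat (𝕜 := ℝ)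
    have h2 := (tendsto_add_atTop_iff_nat 1).2 this
    refine h2.congr fun n => ?_
    show _ = 1 / ((n:ℝ) + 2)
    push_cast; ring_nf
  have hρ1 : ∀ n, (ρ n).rOut ≤ 1 := fun n => by
    show 1 / ((n:ℝ) + 2) ≤ 1
    rw [div_le_one (by positivity)]
    nlinarith [(n.cast_nonneg : (0:ℝ) ≤ n)]
  let k : ℕ → ℝ × EN N → ℝ := fun n => (ρ n).normed volume
  have hkc : ∀ n, HasCompactSupport (k n) := fun n => (ρ n).hasCompactSupport_normed
  have hkd : ∀ n, ContDiff ℝ 1 (k n) := fun n => (ρ n).contDiff_normed (n := 1)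
  refine ⟨fun n => v ⋆[ContinuousLinearMap.mul ℝ ℝ, volume] k n,
    fun n z => ∫ y, k n y • G (z - y), ?_, ?_, ?_, ?_, ?_, ?_⟩
  · intro n
    exact (hkc n).contDiff_convolution_right (n := 1) _ hvl (hkd n)
  · intro n z
    simp only [convolution_def, ContinuousLinearMap.mul_apply']
    refine ⟨integral_nonneg fun y => mul_nonneg (hv0 y) ((ρ n).nonneg_normed _), ?_⟩
    have e : ∫ y, M * k n (z - y) = M := by
      rw [integral_const_mul, integral_sub_left_eq_self (k n) volume z, (ρ n).integral_normed, mul_one]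
    conv_rhs => rw [← e]
    refine integral_mono_of_nonneg (ae_of_all _ fun y => mul_nonneg (hv0 y) ((ρ n).nonneg_normed _)) ?_
      (ae_of_all _ fun y => mul_le_mul_of_nonneg_right (hvM y) ((ρ n).nonneg_normed _))
    exact ((ρ n).integrable_normed.comp_sub_left z).const_mul M
  · have := ContDiffBump.ae_convolution_tendsto_right_of_locallyIntegrable (φ := ρ) (K := 2) hρ0
      (Eventually.of_forall fun n => by
        show 1 / ((n:ℝ) + 2) ≤ 2 * (1 / (2 * ((n:ℝ) + 2)))
        apply le_of_eq; field_simp) hvl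
    filter_upwards [this] with z hz
    refine hz.congr fun n => ?_
    rw [convolution_eq_swap]
    simp only [convolution_def, ContinuousLinearMap.mul_apply', ContinuousLinearMap.lsmul_apply, smul_eq_mul, k]
    congr 1; ext y; ring
  · intro n
    have := (hkc n).continuous_convolution_left (ContinuousLinearMap.lsmul ℝ ℝ) (hkd n).continuous hGl
    exact this
  · intro n z hz e
    have hfd := ((hkc n).hasFDerivAt_convolution_right (ContinuousLinearMap.mul ℝ ℝ) hvl (hkd n) z).fderiv
    have hbasis : ∀ i, fderiv ℝ (v ⋆[ContinuousLinearMap.mul ℝ ℝ, volume] k n) z (0, EuclideanSpace.single i 1)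
        = (∫ y, k n y • G (z - y)) i := by
      intro i
      rw [hfd, convolution_precompR_apply _ hvl ((hkc n).fderiv ℝ) ((hkd n).continuous_fderiv one_ne_zero)]
      simp only [convolution_def, ContinuousLinearMap.mul_apply']
      let ζ : ℝ × EN N → ℝ := fun y => k n (z - y)
      have hζ : ContDiff ℝ 1 ζ := (hkd n).comp (contDiff_const.sub contDiff_id)
      have hζc : HasCompactSupport ζ := (hkc n).comp_homeomorph (Homeomorph.subLeft z)
      have hζd : ∀ y w, fderiv ℝ ζ y w = - fderiv ℝ (k n) (z - y) w := by
        intro y w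
        have h1 : HasFDerivAt ζ ((fderiv ℝ (k n) (z - y)).comp (-(ContinuousLinearMap.id ℝ (ℝ × EN N)))) y :=
          HasFDerivAt.comp y ((hkd n).differentiable one_ne_zero _).hasFDerivAt
            ((hasFDerivAt_id y).const_sub z)
        rw [h1.fderiv]; simp
      have h1 := hw ζ hζ hζc i
      simp only [hζd, mul_neg, integral_neg, neg_inj] at h1
      rw [h1]
      have hint : Integrable (fun y => k n (z - y) • G y) := by
        have : Integrable (fun y => k n y • G (z - y)) := 
          ((hkc n).convolutionExists_left (ContinuousLinearMap.lsmul ℝ ℝ)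
            (hkd n).continuous hGl z)
        simpa using this.comp_sub_left z
      have e1 : ∫ y, k n y • G (z - y) = ∫ y, k n (z - y) • G y := by
        rw [← integral_sub_left_eq_self _ volume z]
        simp
      rw [e1]
      have e2 := (EuclideanSpace.proj (𝕜 := ℝ) i : EN N →L[ℝ] ℝ).integral_comp_comm hint
      refine Eq.trans ?_ e2
      congr 1; ext y
      rw [PiLp.proj_apply]
      by_cases hy : k n (z - y) = 0
      · simp [ζ, hy]
      · have hy' : z - y ∈ Metric.ball (0 : ℝ × EN N) (ρ n).rOut := by
          rw [← (ρ n).support_normed_eq (μ := volume)]; exact hy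
        have h3 : ‖z.2 - y.2‖ < 1 := by
          have : ‖z - y‖ < (ρ n).rOut := by simpa using hy'
          exact (norm_snd_le (z - y)).trans_lt (this.trans_le (hρ1 n))
        have h4 : ‖y.2‖ ≤ r + 1 := by
          have := norm_sub_norm_le y.2 z.2
          rw [norm_sub_rev] at this
          linarith
        have : G y = g y := by
          rw [hG, indicator_of_mem]
          simpa using h4
        rw [this]
        show g y i * k n (z - y) = k n (z - y) * g y i
        exact mul_comm _ _
    have he : e = ∑ i, e i • EuclideanSpace.single i (1:ℝ) := by
      ext j; simp [Pi.single_apply]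
    have : ((0:ℝ), e) = ∑ i, e i • ((0:ℝ), (EuclideanSpace.single i (1:ℝ) : EN N)) := by
      rw [Prod.ext_iff]; constructor
      · simp [Prod.fst_sum]
      · simpa [Prod.snd_sum] using he
    rw [this, map_sum]
    simp only [map_smul, hbasis, smul_eq_mul]
    simp [PiLp.inner_apply]
  · rw [ENNReal.tendsto_nhds_zero]
    intro ε hε
    obtain ⟨δ, hδ, h⟩ := transl_cont volume G hg2 ε hε
    filter_upwards [hρ0.eventually (eventually_lt_nhds hδ)] with n hn
    exact moll_L2 volume G hg2 (ρ n) ε fun y hy => h y (hy.trans hn)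

lemma hasDerivAt_pospow (k : ℕ) (s : ℝ) :
    HasDerivAt (fun s : ℝ => (max s 0) ^ (k + 2)) ((k + 2) * (max s 0) ^ (k + 1)) s := by
  rcases lt_trichotomy s 0 with h | h | h
  · have e : (fun s : ℝ => (max s 0) ^ (k + 2)) =ᶠ[𝓝 s] fun _ => 0 := by
      filter_upwards [eventually_lt_nhds h] with x hx
      simp [max_eq_right hx.le]
    rw [max_eq_right h.le]
    simpa using (hasDerivAt_const s (0:ℝ)).congr_of_eventuallyEq e
  · subst h
    simp only [max_self, ne_eq, Nat.add_eq_zero_iff, one_ne_zero, and_false, not_false_eq_true, zero_pow, mul_zero]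
    rw [hasDerivAt_iff_isLittleO_nhds_zero]
    simp only [zero_add, max_self, ne_eq, Nat.add_eq_zero_iff, OfNat.ofNat_ne_zero, and_false,
      not_false_eq_true, zero_pow, sub_zero, smul_zero]
    have h1 : (fun h : ℝ => (max h 0) ^ (k + 2)) =O[𝓝 0] fun h : ℝ => h ^ (k + 2) := by
      refine Asymptotics.IsBigO.of_bound 1 (Eventually.of_forall fun x => ?_)
      rw [one_mul, norm_pow, norm_pow]
      gcongr
      rw [Real.norm_of_nonneg (le_max_right _ _)]
      exact max_le (le_abs_self x) (abs_nonneg x)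
    refine h1.trans_isLittleO ?_
    have := Asymptotics.isLittleO_pow_pow (𝕜 := ℝ) (m := 1) (n := k + 2) (by omega)
    simpa using this
  · have e : (fun s : ℝ => (max s 0) ^ (k + 2)) =ᶠ[𝓝 s] fun s => s ^ (k + 2) := by
      filter_upwards [eventually_gt_nhds h] with x hx
      simp [max_eq_left (le_of_lt hx)]
    rw [max_eq_left h.le]
    have := (hasDerivAt_pow (k + 2) s).congr_of_eventuallyEq e
    simpa using this

lemma contDiff_pospow (k : ℕ) : ContDiff ℝ 1 (fun s : ℝ => (max s 0) ^ (k + 2)) := by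
  rw [contDiff_one_iff_deriv]
  refine ⟨fun s => (hasDerivAt_pospow k s).differentiableAt, ?_⟩
  have : deriv (fun s : ℝ => (max s 0) ^ (k + 2)) = fun s : ℝ => ((k:ℝ) + 2) * (max s 0) ^ (k + 1) := by
    ext s; exact (hasDerivAt_pospow k s).deriv
  rw [this]
  fun_prop

/-- divergence -/
def dvg {N : ℕ} (W : EN N → EN N) (x : EN N) : ℝ :=
  ∑ i, (fderiv ℝ W x (EuclideanSpace.single i 1)) i

lemma continuous_dvg {N : ℕ} {W : EN N → EN N} (hW : ContDiff ℝ 1 W) : Continuous (dvg W) := by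
  unfold dvg
  refine continuous_finsetSum _ fun i _ => ?_
  have h1 : Continuous fun x => fderiv ℝ W x (EuclideanSpace.single i 1) :=
    (hW.continuous_fderiv one_ne_zero).clm_apply continuous_const
  exact (EuclideanSpace.proj (𝕜 := ℝ) i : EN N →L[ℝ] ℝ).continuous.comp h1

lemma prod_basis {N : ℕ} (e : EN N) :
    ((0:ℝ), e) = ∑ i, e i • ((0:ℝ), (EuclideanSpace.single i (1:ℝ) : EN N)) := by
  have he : e = ∑ i, e i • EuclideanSpace.single i (1:ℝ) := by
    ext j; simp [Pi.single_apply]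
  rw [Prod.ext_iff]; constructor
  · simp [Prod.fst_sum]
  · simpa [Prod.snd_sum] using he

lemma ibp {N : ℕ} (χ : ℝ → ℝ) (hχ : ContDiff ℝ 1 χ) (W : EN N → EN N) (hW : ContDiff ℝ 1 W)
    (ζ : ℝ × EN N → ℝ) (hζ : ContDiff ℝ 1 ζ)
    (K : Set (ℝ × EN N)) (hK : IsCompact K)
    (hc : (∀ z, z ∉ K → ζ z = 0) ∨ (∀ z, z ∉ K → χ z.1 • W z.2 = 0)) :
    ∫ z : ℝ × EN N, χ z.1 * fderiv ℝ ζ z (0, W z.2) = - ∫ z : ℝ × EN N, χ z.1 * dvg W z.2 * ζ z := by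
  have hWi : ∀ i, ContDiff ℝ 1 (fun x => W x i) := fun i =>
    (EuclideanSpace.proj (𝕜 := ℝ) i : EN N →L[ℝ] ℝ).contDiff.comp hW
  let f : Fin N → ℝ × EN N → ℝ := fun i z => χ z.1 * W z.2 i
  have hf : ∀ i, ContDiff ℝ 1 (f i) := fun i =>
    (hχ.comp contDiff_fst).mul ((hWi i).comp contDiff_snd)
  have hfd : ∀ i z, fderiv ℝ (f i) z (0, EuclideanSpace.single i 1) =
      χ z.1 * (fderiv ℝ W z.2 (EuclideanSpace.single i 1)) i := by
    intro i z
    have h1 : HasFDerivAt (fun z : ℝ × EN N => χ z.1) ((fderiv ℝ χ z.1).comp (ContinuousLinearMap.fst ℝ ℝ (EN N))) z :=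
      ((hχ.differentiable one_ne_zero z.1).hasFDerivAt).comp z hasFDerivAt_fst
    have h2 : HasFDerivAt (fun z : ℝ × EN N => W z.2 i)
        ((EuclideanSpace.proj (𝕜 := ℝ) i : EN N →L[ℝ] ℝ).comp ((fderiv ℝ W z.2).comp (ContinuousLinearMap.snd ℝ ℝ (EN N)))) z :=
      (EuclideanSpace.proj (𝕜 := ℝ) i : EN N →L[ℝ] ℝ).hasFDerivAt.comp z
        (((hW.differentiable one_ne_zero z.2).hasFDerivAt).comp z hasFDerivAt_snd)
    have h3 : HasFDerivAt (f i) _ z := h1.mul h2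
    rw [h3.fderiv]
    simp
  have hc' : ∀ i, HasCompactSupport (ζ) ∨ HasCompactSupport (f i) := by
    intro i
    rcases hc with h | h
    · left; exact HasCompactSupport.intro hK h
    · right; refine HasCompactSupport.intro hK fun z hz => ?_
      have := congrArg (fun w : EN N => w i) (h z hz)
      simpa [f] using this
  have hζd : ∀ i : Fin N, Continuous fun z => fderiv ℝ ζ z (0, EuclideanSpace.single i 1) := fun i =>
    (hζ.continuous_fderiv one_ne_zero).clm_apply continuous_const
  have hfdc : ∀ i : Fin N, Continuous fun z => fderiv ℝ (f i) z (0, EuclideanSpace.single i 1) := fun i =>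
    ((hf i).continuous_fderiv one_ne_zero).clm_apply continuous_const
  have I1 : ∀ i : Fin N, Integrable fun z => fderiv ℝ (f i) z (0, EuclideanSpace.single i 1) * ζ z := by
    intro i
    refine ((hfdc i).mul hζ.continuous).integrable_of_hasCompactSupport ?_
    rcases hc' i with h | h
    · exact h.mul_left
    · exact (h.fderiv_apply ℝ _).mul_right
  have I2 : ∀ i : Fin N, Integrable fun z => f i z * fderiv ℝ ζ z (0, EuclideanSpace.single i 1) := by
    intro i
    refine ((hf i).continuous.mul (hζd i)).integrable_of_hasCompactSupport ?_
    rcases hc' i with h | h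
    · exact (h.fderiv_apply ℝ _).mul_left
    · exact h.mul_right
  have I3 : ∀ i : Fin N, Integrable fun z => f i z * ζ z := by
    intro i
    refine ((hf i).continuous.mul hζ.continuous).integrable_of_hasCompactSupport ?_
    rcases hc' i with h | h
    · exact h.mul_left
    · exact h.mul_right
  have key : ∀ i, ∫ z, f i z * fderiv ℝ ζ z (0, EuclideanSpace.single i 1) =
      - ∫ z, fderiv ℝ (f i) z (0, EuclideanSpace.single i 1) * ζ z := fun i =>
    integral_mul_fderiv_eq_neg_fderiv_mul_of_integrable (I1 i) (I2 i) (I3 i)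
      (fun z _ => (hf i).differentiable one_ne_zero z) (fun z _ => hζ.differentiable one_ne_zero z)
  have e1 : ∀ z : ℝ × EN N, χ z.1 * fderiv ℝ ζ z (0, W z.2) =
      ∑ i, f i z * fderiv ℝ ζ z (0, EuclideanSpace.single i 1) := by
    intro z
    rw [prod_basis, map_sum, Finset.mul_sum]
    refine Finset.sum_congr rfl fun i _ => ?_
    rw [map_smul, smul_eq_mul, mul_assoc]
  have e2 : ∀ z : ℝ × EN N, χ z.1 * dvg W z.2 * ζ z =
      ∑ i, fderiv ℝ (f i) z (0, EuclideanSpace.single i 1) * ζ z := by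
    intro z
    unfold dvg
    rw [Finset.mul_sum, Finset.sum_mul]
    refine Finset.sum_congr rfl fun i _ => ?_
    rw [hfd]
  simp_rw [e1, e2]
  rw [integral_finsetSum _ fun i _ => I2 i, integral_finsetSum _ fun i _ => I1 i, ← Finset.sum_neg_distrib]
  exact Finset.sum_congr rfl fun i _ => key i

/-- test data -/
structure TD (N : ℕ) where
  χ : ℝ → ℝ
  hχ : ContDiff ℝ 1 χ
  χ0 : ∀ t, 0 ≤ χ t
  χc : HasCompactSupport χ
  φ : EN N → ℝ
  Wφ : EN N → EN N
  hφ : ContDiff ℝ 1 φ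
  hWφ : ContDiff ℝ 1 Wφ
  φ0 : ∀ x, 0 ≤ φ x
  φd : ∀ x e, fderiv ℝ φ x e = inner ℝ (Wφ x) e
  r : ℝ
  φr : ∀ x, r < ‖x‖ → φ x = 0
  Wφr : ∀ x, r < ‖x‖ → Wφ x = 0
  V : EN N → ℝ
  W : EN N → EN N
  hV : ContDiff ℝ 1 V
  hW : ContDiff ℝ 1 W
  V0 : ∀ x, 0 ≤ V x
  Vd : ∀ x e, fderiv ℝ V x e = inner ℝ (W x) e

namespace TD
variable {N : ℕ} (D : TD N)

def K : Set (ℝ × EN N) := tsupport D.χ ×ˢ Metric.closedBall 0 D.r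

lemma K_compact : IsCompact D.K := D.χc.isCompact.prod (isCompact_closedBall _ _)

def P (v : ℝ × EN N → ℝ) (z : ℝ × EN N) : ℝ :=
  D.χ z.1 * D.φ z.2 * (max (v z - D.V z.2) 0) ^ 2

def Jv (v : ℝ × EN N → ℝ) (z : ℝ × EN N) : ℝ :=
  (max (v z - D.V z.2) 0) ^ 3 / 3

def Q (v : ℝ × EN N → ℝ) (γ : ℝ × EN N → EN N) (z : ℝ × EN N) : EN N :=
  D.χ z.1 • ((max (v z - D.V z.2) 0) ^ 2 • D.Wφ z.2
    + (D.φ z.2 * (2 * max (v z - D.V z.2) 0)) • (γ z - D.W z.2))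

lemma χ_out {z : ℝ × EN N} (h : z ∉ D.K) : D.χ z.1 = 0 ∨ D.r < ‖z.2‖ := by
  by_contra! hh
  apply h
  refine ⟨subset_tsupport _ hh.1, ?_⟩
  simpa using hh.2

lemma P_out (v : ℝ × EN N → ℝ) {z : ℝ × EN N} (h : z ∉ D.K) : D.P v z = 0 := by
  rcases D.χ_out h with h | h
  · simp [P, h]
  · simp [P, D.φr _ h]

lemma Q_out (v : ℝ × EN N → ℝ) (γ) {z : ℝ × EN N} (h : z ∉ D.K) : D.Q v γ z = 0 := by
  rcases D.χ_out h with h | h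
  · simp [Q, h]
  · simp [Q, D.φr _ h, D.Wφr _ h]

lemma W_out {z : ℝ × EN N} (h : z ∉ D.K) : D.χ z.1 • D.Wφ z.2 = 0 := by
  rcases D.χ_out h with h | h
  · simp [h]
  · simp [D.Wφr _ h]

lemma P_nonneg (v : ℝ × EN N → ℝ) (z) : 0 ≤ D.P v z := by
  have := D.χ0 z.1; have := D.φ0 z.2
  unfold P; positivity

variable {v : ℝ × EN N → ℝ} {γ : ℝ × EN N → EN N}

lemma P_contDiff (hv : ContDiff ℝ 1 v) : ContDiff ℝ 1 (D.P v) := by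
  have h1 : ContDiff ℝ 1 fun z : ℝ × EN N => v z - D.V z.2 := hv.sub (D.hV.comp contDiff_snd)
  exact ((D.hχ.comp contDiff_fst).mul (D.hφ.comp contDiff_snd)).mul ((contDiff_pospow 0).comp h1)

lemma Jv_contDiff (hv : ContDiff ℝ 1 v) : ContDiff ℝ 1 (D.Jv v) := by
  have h1 : ContDiff ℝ 1 fun z : ℝ × EN N => v z - D.V z.2 := hv.sub (D.hV.comp contDiff_snd)
  exact ((contDiff_pospow 1).comp h1).div_const 3

lemma Q_cont (hv : Continuous v) (hγ : Continuous γ) : Continuous (D.Q v γ) := by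
  have := D.hχ.continuous
  have := D.hφ.continuous
  have := D.hWφ.continuous
  have := D.hV.continuous
  have := D.hW.continuous
  unfold Q
  fun_prop

lemma P_hcs (v : ℝ × EN N → ℝ) : HasCompactSupport (D.P v) :=
  HasCompactSupport.intro D.K_compact fun _ h => D.P_out v h

lemma Q_hcs (v : ℝ × EN N → ℝ) (γ) : HasCompactSupport (D.Q v γ) :=
  HasCompactSupport.intro D.K_compact fun _ h => D.Q_out v γ h

lemma diff_v (hv : ContDiff ℝ 1 v) (z : ℝ × EN N) :
    HasFDerivAt (fun z : ℝ × EN N => v z - D.V z.2)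
      (fderiv ℝ v z - (fderiv ℝ D.V z.2).comp (ContinuousLinearMap.snd ℝ ℝ (EN N))) z :=
  ((hv.differentiable one_ne_zero z).hasFDerivAt).sub
    (((D.hV.differentiable one_ne_zero z.2).hasFDerivAt).comp z hasFDerivAt_snd)

lemma P_deriv (hv : ContDiff ℝ 1 v)
    (hd : ∀ z, ‖z.2‖ ≤ D.r → ∀ e : EN N, fderiv ℝ v z (0, e) = inner ℝ (γ z) e) (z : ℝ × EN N) (e : EN N) :
    fderiv ℝ (D.P v) z (0, e) = inner ℝ (D.Q v γ z) e := by
  by_cases hz : ‖z.2‖ ≤ D.r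
  · have h1 : HasFDerivAt (fun z : ℝ × EN N => D.χ z.1) ((fderiv ℝ D.χ z.1).comp (ContinuousLinearMap.fst ℝ ℝ (EN N))) z :=
      ((D.hχ.differentiable one_ne_zero z.1).hasFDerivAt).comp z hasFDerivAt_fst
    have h2 : HasFDerivAt (fun z : ℝ × EN N => D.φ z.2) ((fderiv ℝ D.φ z.2).comp (ContinuousLinearMap.snd ℝ ℝ (EN N))) z :=
      ((D.hφ.differentiable one_ne_zero z.2).hasFDerivAt).comp z hasFDerivAt_snd
    have h3 := (hasDerivAt_pospow 0 (v z - D.V z.2)).comp_hasFDerivAt z (D.diff_v hv z)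
    have h4 : HasFDerivAt (D.P v) _ z := (h1.mul h2).mul h3
    rw [h4.fderiv]
    simp [D.φd, D.Vd, hd z hz, Q, inner_add_left, inner_smul_left, inner_sub_left]
    ring
  · push Not at hz
    have e0 : D.P v =ᶠ[𝓝 z] fun _ => 0 := by
      have : ∀ᶠ y : ℝ × EN N in 𝓝 z, D.r < ‖y.2‖ :=
        (continuous_snd.norm.tendsto z).eventually (eventually_gt_nhds hz)
      filter_upwards [this] with y hy
      simp [P, D.φr _ hy]
    rw [e0.fderiv_eq]
    simp [Q, D.φr _ hz, D.Wφr _ hz]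

lemma Jv_deriv (hv : ContDiff ℝ 1 v)
    (hd : ∀ z, ‖z.2‖ ≤ D.r → ∀ e : EN N, fderiv ℝ v z (0, e) = inner ℝ (γ z) e) (z : ℝ × EN N) :
    D.χ z.1 * fderiv ℝ (D.Jv v) z (0, D.Wφ z.2) =
      D.χ z.1 * ((max (v z - D.V z.2) 0) ^ 2 * inner ℝ (D.Wφ z.2) (γ z - D.W z.2)) := by
  by_cases hz : ‖z.2‖ ≤ D.r
  · have h3 := (hasDerivAt_pospow 1 (v z - D.V z.2)).comp_hasFDerivAt z (D.diff_v hv z)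
    have h4 : HasFDerivAt (D.Jv v) _ z := h3.mul_const (1/3 : ℝ) |>.congr_of_eventuallyEq
      (Eventually.of_forall fun z => by simp [Jv, div_eq_mul_inv])
    rw [h4.fderiv]
    simp [D.Vd, hd z hz, inner_sub_right, real_inner_comm]
    left
    ring
  · push Not at hz
    rw [D.Wφr _ hz]
    have h0 : ((0:ℝ), (0 : EN N)) = 0 := rfl
    rw [h0, map_zero]
    simp

lemma L1 (hv : ContDiff ℝ 1 v) (hγ : Continuous γ)
    (hd : ∀ z, ‖z.2‖ ≤ D.r → ∀ e : EN N, fderiv ℝ v z (0, e) = inner ℝ (γ z) e) :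
    - (∫ z : ℝ × EN N, D.χ z.1 * dvg D.Wφ z.2 * D.Jv v z) - ∫ z : ℝ × EN N, dvg D.W z.2 * D.P v z
      ≤ ∫ z, inner ℝ (D.Q v γ z) (γ z) := by
  have i1 := ibp (fun _ => 1) contDiff_const D.W D.hW (D.P v) (D.P_contDiff hv) D.K D.K_compact
    (Or.inl fun z hz => D.P_out v hz)
  have i2 := ibp D.χ D.hχ D.Wφ D.hWφ (D.Jv v) (D.Jv_contDiff hv) D.K D.K_compact
    (Or.inr fun z hz => D.W_out hz)
  simp only [one_mul] at i1
  rw [sub_eq_add_neg, ← i1, ← i2]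
  have c1 := D.hχ.continuous
  have c2 := D.hWφ.continuous
  have c3 := D.hW.continuous
  have cJ := (D.Jv_contDiff hv).continuous_fderiv one_ne_zero
  have cP := (D.P_contDiff hv).continuous_fderiv one_ne_zero
  have cQ := D.Q_cont hv.continuous hγ
  have I1 : Integrable fun z : ℝ × EN N => D.χ z.1 * fderiv ℝ (D.Jv v) z (0, D.Wφ z.2) := by
    refine Continuous.integrable_of_hasCompactSupport (by fun_prop) (HasCompactSupport.intro D.K_compact fun z hz => ?_)
    rcases D.χ_out hz with h | h
    · simp [h]
    · have h0 : ((0:ℝ), (0 : EN N)) = 0 := rfl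
      rw [D.Wφr _ h, h0, map_zero, mul_zero]
  have I2 : Integrable fun z : ℝ × EN N => fderiv ℝ (D.P v) z (0, D.W z.2) := by
    simp_rw [D.P_deriv hv hd]
    refine Continuous.integrable_of_hasCompactSupport (by fun_prop) (HasCompactSupport.intro D.K_compact fun z hz => ?_)
    simp [D.Q_out v γ hz]
  have I3 : Integrable fun z : ℝ × EN N => inner ℝ (D.Q v γ z) (γ z) := by
    refine Continuous.integrable_of_hasCompactSupport (by fun_prop) (HasCompactSupport.intro D.K_compact fun z hz => ?_)
    simp [D.Q_out v γ hz]
  rw [← integral_add I1 I2]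
  refine integral_mono (I1.add I2) I3 fun z => ?_
  simp only [D.Jv_deriv hv hd z, D.P_deriv hv hd]
  have : inner ℝ (D.Q v γ z) (γ z) = D.χ z.1 * ((max (v z - D.V z.2) 0) ^ 2 * inner ℝ (D.Wφ z.2) (γ z - D.W z.2))
      + D.χ z.1 * (D.φ z.2 * (2 * max (v z - D.V z.2) 0)) * ‖γ z - D.W z.2‖^2 + inner ℝ (D.Q v γ z) (D.W z.2) := by
    rw [norm_sub_sq_real, ← real_inner_self_eq_norm_sq, ← real_inner_self_eq_norm_sq,
      real_inner_comm (D.W z.2) (γ z)]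
    simp only [Q, RCLike.conj_to_real, inner_add_left, inner_smul_left, inner_sub_left, inner_sub_right]
    rw [real_inner_comm (D.W z.2) (γ z)]
    ring
  rw [this]
  have := D.χ0 z.1; have := D.φ0 z.2
  have : 0 ≤ D.χ z.1 * (D.φ z.2 * (2 * max (v z - D.V z.2) 0)) * ‖γ z - D.W z.2‖^2 := by positivity
  linarith
end TD

lemma sq_of_lint {X F : Type*} [MeasurableSpace X] {μ : Measure X} [NormedAddCommGroup F]
    {f : X → F} (hf : AEStronglyMeasurable f μ) {B : ℝ} (hB : 0 ≤ B)
    (h : ∫⁻ z, ‖f z‖ₑ ^ 2 ∂μ ≤ ENNReal.ofReal B) :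
    MemLp f 2 μ ∧ Integrable (fun z => ‖f z‖ ^ 2) μ ∧ ∫ z, ‖f z‖ ^ 2 ∂μ ≤ B := by
  have e : ∀ z, ENNReal.ofReal (‖f z‖ ^ 2) = ‖f z‖ₑ ^ 2 := fun z => by
    rw [ENNReal.ofReal_pow (norm_nonneg _), ofReal_norm]
  have hi : Integrable (fun z => ‖f z‖ ^ 2) μ := by
    refine ⟨by fun_prop, ?_⟩
    rw [hasFiniteIntegral_iff_ofReal (ae_of_all _ fun z => by positivity)]
    simp_rw [e]
    exact h.trans_lt ENNReal.ofReal_lt_top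
  refine ⟨(memLp_two_iff_integrable_sq_norm hf).2 hi, hi, ?_⟩
  rw [integral_eq_lintegral_of_nonneg_ae (ae_of_all _ fun z => by positivity) hi.1]
  simp_rw [e]
  exact ENNReal.toReal_le_of_le_ofReal hB h

namespace TD
variable {N : ℕ} (D : TD N)

lemma bounds : ∃ c : ℝ, 0 ≤ c ∧ (∀ t, D.χ t ≤ c) ∧ (∀ x, D.φ x ≤ c) ∧ (∀ x, ‖D.Wφ x‖ ≤ c) ∧
    (∀ x, ‖x‖ ≤ D.r → ‖D.W x‖ ≤ c) ∧ (∀ x, ‖x‖ ≤ D.r → |dvg D.W x| ≤ c) ∧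
    (∀ x, |dvg D.Wφ x| ≤ c) := by
  have hb : IsCompact (Metric.closedBall (0 : EN N) D.r) := isCompact_closedBall _ _
  obtain ⟨c1, h1⟩ := D.χc.exists_bound_of_continuous D.hχ.continuous
  obtain ⟨c2, h2⟩ := (HasCompactSupport.intro hb (f := D.φ) fun x hx => D.φr x (by simpa using hx)).exists_bound_of_continuous D.hφ.continuous
  have hs := (HasCompactSupport.intro hb (f := D.Wφ) fun x hx => D.Wφr x (by simpa using hx))
  obtain ⟨c3, h3⟩ := hs.exists_bound_of_continuous D.hWφ.continuous
  obtain ⟨c4, h4⟩ := hb.exists_bound_of_continuousOn D.hW.continuous.continuousOn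
  obtain ⟨c5, h5⟩ := hb.exists_bound_of_continuousOn (continuous_dvg D.hW).continuousOn
  have hs' : HasCompactSupport (dvg D.Wφ) := by
    refine HasCompactSupport.intro (hs.fderiv (𝕜 := ℝ)) fun x hx => ?_
    unfold dvg
    rw [image_eq_zero_of_notMem_tsupport hx]
    simp
  obtain ⟨c6, h6⟩ := hs'.exists_bound_of_continuous (continuous_dvg D.hWφ)
  refine ⟨max 0 (max (max c1 c2) (max (max c3 c4) (max c5 c6))), le_max_left _ _, fun t => ?_, fun x => ?_, fun x => ?_, fun x hx => ?_, fun x hx => ?_, fun x => ?_⟩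
  · have := (le_abs_self _).trans (h1 t)
    simp only [le_max_iff]; tauto
  · have := (le_abs_self _).trans (h2 x)
    simp only [le_max_iff]; tauto
  · have := h3 x
    simp only [le_max_iff]; tauto
  · have := h4 x (by simpa using hx)
    simp only [le_max_iff]; tauto
  · have := h5 x (by simpa using hx)
    simp only [le_max_iff]; tauto
  · have := h6 x
    simp only [le_max_iff]; tauto

lemma K_r {z : ℝ × EN N} (h : z ∈ D.K) : ‖z.2‖ ≤ D.r := by simpa using h.2

lemma P_le {M c : ℝ} (hc0 : 0 ≤ c) (hc1 : ∀ t, D.χ t ≤ c) (hc2 : ∀ x, D.φ x ≤ c) (v : ℝ × EN N → ℝ)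
    (z : ℝ × EN N) (hv : 0 ≤ v z ∧ v z ≤ M) : D.P v z ≤ D.K.indicator (fun _ => c * c * M ^ 2) z := by
  by_cases hz : z ∈ D.K
  · rw [indicator_of_mem hz]
    unfold P
    have hm : max (v z - D.V z.2) 0 ≤ M := max_le (by linarith [D.V0 z.2]) (by linarith)
    have := D.χ0 z.1; have := D.φ0 z.2
    have := hc1 z.1; have := hc2 z.2
    gcongr
  · rw [indicator_of_notMem hz, D.P_out v hz]

lemma Q_bound (M : ℝ) (hM : 0 ≤ M) (G : ℝ × EN N → EN N) (hG : MemLp G 2 volume) :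
    ∃ C : ℝ, 0 ≤ C ∧ ∀ (v : ℝ × EN N → ℝ) (γ : ℝ × EN N → EN N), Continuous v → Continuous γ →
      (∀ z, 0 ≤ v z ∧ v z ≤ M) → ∫⁻ z, ‖γ z - G z‖ₑ ^ 2 ≤ ENNReal.ofReal 1 →
      ∫ z, ‖D.Q v γ z‖ ^ 2 ≤ C ∧ ∫ z, D.P v z ^ 2 ≤ C := by
  obtain ⟨c, hc0, h1, h2, h3, h4, -, -⟩ := D.bounds
  set d := c * (M ^ 2 * c + c * (2 * M) * (c + 1)) with hd
  have hd0 : 0 ≤ d := by positivity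
  have hKv : volume D.K ≠ ⊤ := D.K_compact.measure_lt_top.ne
  have hGi : Integrable (fun z => ‖G z‖ ^ 2) := (memLp_two_iff_integrable_sq_norm hG.1).1 hG
  have hKm : MeasurableSet D.K := D.K_compact.isClosed.measurableSet
  have hKi : ∀ a : ℝ, Integrable (D.K.indicator (fun _ => a)) := fun a => (integrable_indicator_iff hKm).2 (integrableOn_const hKv)
  refine ⟨max 0 (max (3 * d^2 * ((∫ z, D.K.indicator (fun _ => (1:ℝ)) z) + 1 + ∫ z, ‖G z‖ ^ 2))
    (∫ z, D.K.indicator (fun _ => (c * c * M ^ 2)^2) z)), le_max_left _ _, fun v γ hv hγ hvM hB => ⟨?_, ?_⟩⟩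
  · refine le_trans ?_ ((le_max_left _ _).trans (le_max_right _ _))
    obtain ⟨-, j1, j2⟩ := sq_of_lint (f := fun z => γ z - G z) (hγ.aestronglyMeasurable.sub hG.1) zero_le_one hB
    have : ∀ z, ‖D.Q v γ z‖ ^ 2 ≤ 3 * d^2 * (D.K.indicator (fun _ => (1:ℝ)) z + ‖γ z - G z‖ ^ 2 + ‖G z‖ ^ 2) := by
      intro z
      by_cases hz : z ∈ D.K
      · rw [indicator_of_mem hz]
        have hm : max (v z - D.V z.2) 0 ≤ M := max_le (by linarith [D.V0 z.2, hvM z]) hM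
        have hm0 : 0 ≤ max (v z - D.V z.2) 0 := le_max_right _ _
        have a1 := D.χ0 z.1; have a2 := D.φ0 z.2
        have a3 := h1 z.1; have a4 := h2 z.2
        have a5 := h3 z.2; have a6 := h4 z.2 (D.K_r hz)
        have t1 : ‖γ z - D.W z.2‖ ≤ (c + 1) * (1 + ‖γ z - G z‖ + ‖G z‖) := by
          have : γ z - D.W z.2 = (γ z - G z) + G z - D.W z.2 := by abel
          rw [this]
          refine (norm_sub_le _ _).trans ?_
          have := norm_add_le (γ z - G z) (G z)
          nlinarith [norm_nonneg (γ z - G z), norm_nonneg (G z)]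
        have t2 : ‖D.Q v γ z‖ ≤ d * (1 + ‖γ z - G z‖ + ‖G z‖) := by
          unfold Q
          rw [norm_smul, Real.norm_of_nonneg a1]
          have t3 : ‖(max (v z - D.V z.2) 0) ^ 2 • D.Wφ z.2
            + (D.φ z.2 * (2 * max (v z - D.V z.2) 0)) • (γ z - D.W z.2)‖ ≤
             M ^ 2 * c + c * (2 * M) * ((c + 1) * (1 + ‖γ z - G z‖ + ‖G z‖)) := by
            refine (norm_add_le _ _).trans ?_
            rw [norm_smul, norm_smul, Real.norm_of_nonneg (by positivity), Real.norm_of_nonneg (by positivity)]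
            gcongr
          calc _ ≤ c * (M ^ 2 * c + c * (2 * M) * ((c + 1) * (1 + ‖γ z - G z‖ + ‖G z‖))) := by gcongr
            _ ≤ _ := by
              rw [hd]
              have : 0 ≤ c * (M ^ 2 * c) * (‖γ z - G z‖ + ‖G z‖) := by positivity
              nlinarith
        calc ‖D.Q v γ z‖ ^ 2 ≤ (d * (1 + ‖γ z - G z‖ + ‖G z‖))^2 := by gcongr
          _ = d^2 * (1 + ‖γ z - G z‖ + ‖G z‖)^2 := by ring
          _ ≤ d^2 * (3 * (1 + ‖γ z - G z‖^2 + ‖G z‖^2)) := by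
            gcongr
            nlinarith [sq_nonneg (1 - ‖γ z - G z‖), sq_nonneg (1 - ‖G z‖), sq_nonneg (‖γ z - G z‖ - ‖G z‖)]
          _ = _ := by ring
      · rw [D.Q_out v γ hz, indicator_of_notMem hz]
        rw [norm_zero, zero_add, zero_pow two_ne_zero]
        positivity
    have j3 : Integrable (fun z => D.K.indicator (fun _ => (1:ℝ)) z + ‖γ z - G z‖ ^ 2) := (hKi 1).add j1
    have I : Integrable (fun z => 3 * d^2 * (D.K.indicator (fun _ => (1:ℝ)) z + ‖γ z - G z‖ ^ 2 + ‖G z‖ ^ 2)) :=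
      (((hKi 1).add j1).add hGi).const_mul _
    refine (integral_mono_of_nonneg (ae_of_all _ fun z => by positivity) I (ae_of_all _ this)).trans ?_
    rw [integral_const_mul, integral_add j3 hGi, integral_add (hKi 1) j1]
    gcongr
  · refine le_trans ?_ ((le_max_right _ _).trans (le_max_right _ _))
    refine integral_mono_of_nonneg (ae_of_all _ fun z => by positivity) (hKi _) (ae_of_all _ fun z => ?_)
    have := D.P_le hc0 h1 h2 v z (hvM z)
    have h0 := D.P_nonneg v z
    by_cases hz : z ∈ D.K
    · simp only [indicator_of_mem hz] at this ⊢
      gcongr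
    · simp [D.P_out v hz, hz]

lemma L3 (M : ℝ) (hM : 0 ≤ M) (G : ℝ × EN N → EN N) (hG : MemLp G 2 volume)
    (F : ℝ × EN N → ℝ) (hF : MemLp F 2 volume) (ε : ℝ) (hε : 0 < ε) :
    ∃ η > 0, ∃ δ > 0, ∀ (v : ℝ × EN N → ℝ) (γ : ℝ × EN N → EN N), ContDiff ℝ 1 v → Continuous γ →
      (∀ z, ‖z.2‖ ≤ D.r → ∀ e : EN N, fderiv ℝ v z (0, e) = inner ℝ (γ z) e) →
      (∀ z, 0 ≤ v z ∧ v z ≤ M) → ∫⁻ z, ‖γ z - G z‖ₑ ^ 2 ≤ ENNReal.ofReal η → ∀ θ : ℝ, |θ| < δ →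
      - (∫ z, inner ℝ (D.Q v γ z) (G (z - (θ, 0)))) - ∫ z, F (z - (θ, 0)) * D.P v z
       ≤ (∫ z : ℝ × EN N, D.χ z.1 * dvg D.Wφ z.2 * D.Jv v z) + (∫ z : ℝ × EN N, dvg D.W z.2 * D.P v z)
        - (∫ z, F z * D.P v z) + ε := by
  obtain ⟨C, hC, hQ⟩ := D.Q_bound M hM G hG
  set s := ε / (4 * (C + 1)) with hs
  have hs0 : 0 < s := by positivity
  set η := min 1 (s * ε / 10) with hη
  have hη0 : 0 < η := by positivity
  obtain ⟨δ1, hδ1, H1⟩ := transl_cont volume G hG (ENNReal.ofReal η) (by simpa using hη0)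
  obtain ⟨δ2, hδ2, H2⟩ := transl_cont volume F hF (ENNReal.ofReal η) (by simpa using hη0)
  refine ⟨η, hη0, min δ1 δ2, lt_min hδ1 hδ2, fun v γ hv hγ hd hvM hB θ hθ => ?_⟩
  have hn : ‖((θ, 0) : ℝ × EN N)‖ = |θ| := by simp [Prod.norm_def]
  have H1 := H1 (θ, 0) (by rw [hn]; exact hθ.trans_le (min_le_left _ _))
  have H2 := H2 (θ, 0) (by rw [hn]; exact hθ.trans_le (min_le_right _ _))
  obtain ⟨hQ1, hQ2⟩ := hQ v γ hv.continuous hγ hvM (hB.trans (ENNReal.ofReal_le_ofReal (min_le_left _ _)))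
  have mp := measurePreserving_sub_right (volume : Measure (ℝ × EN N)) (θ, 0)
  have hGθ : MemLp (fun z => G (z - (θ, 0))) 2 volume := hG.comp_measurePreserving mp
  have hFθ : MemLp (fun z => F (z - (θ, 0))) 2 volume := hF.comp_measurePreserving mp
  obtain ⟨mB, iB, bB⟩ := sq_of_lint (f := fun z => γ z - G z) (hγ.aestronglyMeasurable.sub hG.1) hη0.le hB
  obtain ⟨mA, iA, bA⟩ := sq_of_lint (f := fun z => G (z - (θ, 0)) - G z) (hGθ.1.sub hG.1) hη0.le H1
  obtain ⟨mF, iF, bF⟩ := sq_of_lint (f := fun z => F (z - (θ, 0)) - F z) (hFθ.1.sub hF.1) hη0.le H2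
  have mQ : MemLp (D.Q v γ) 2 volume := (D.Q_cont hv.continuous hγ).memLp_of_hasCompactSupport (D.Q_hcs v γ)
  have mP : MemLp (D.P v) 2 volume := (D.P_contDiff hv).continuous.memLp_of_hasCompactSupport (D.P_hcs v)
  have iQ := (memLp_two_iff_integrable_sq_norm mQ.1).1 mQ
  have iP : Integrable fun z => D.P v z ^ 2 := mP.integrable_sq
  have iQγ : Integrable fun z => inner ℝ (D.Q v γ z) (γ z) := by
    have cQ := D.Q_cont hv.continuous hγ
    refine Continuous.integrable_of_hasCompactSupport (by fun_prop) (HasCompactSupport.intro D.K_compact fun z hz => ?_)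
    simp [D.Q_out v γ hz]
  have iFP : Integrable fun z => F z * D.P v z := hF.integrable_mul mP
  have iFP' : Integrable fun z => F (z - (θ, 0)) * D.P v z := hFθ.integrable_mul mP
  have iQG : Integrable fun z => inner ℝ (D.Q v γ z) (G (z - (θ, 0))) := by
    refine (mQ.norm.integrable_mul hGθ.norm).mono' (mQ.1.inner hGθ.1) (ae_of_all _ fun z => ?_)
    exact norm_inner_le_norm _ _
  have l1 := D.L1 hv hγ hd
  have y1 : ∫ z, (inner ℝ (D.Q v γ z) (γ z) - inner ℝ (D.Q v γ z) (G (z - (θ, 0)))) ≤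
      ∫ z, (s * ‖D.Q v γ z‖ ^ 2 + s⁻¹ * (2 * ‖γ z - G z‖ ^ 2 + 2 * ‖G (z - (θ, 0)) - G z‖ ^ 2)) := by
    refine integral_mono (iQγ.sub iQG) ((iQ.const_mul _).add (((iB.const_mul _).add (iA.const_mul _)).const_mul _)) fun z => ?_
    simp only
    rw [← inner_sub_right]
    refine (real_inner_le_norm _ _).trans ?_
    have e1 : γ z - G (z - (θ, 0)) = (γ z - G z) - (G (z - (θ, 0)) - G z) := by abel
    have e2 : ‖γ z - G (z - (θ, 0))‖ ≤ ‖γ z - G z‖ + ‖G (z - (θ, 0)) - G z‖ := by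
      rw [e1]; exact norm_sub_le _ _
    have e3 : ‖γ z - G (z - (θ, 0))‖^2 ≤ 2 * ‖γ z - G z‖^2 + 2 * ‖G (z - (θ, 0)) - G z‖^2 := by
      nlinarith [norm_nonneg (γ z - G (z - (θ, 0))), sq_nonneg (‖γ z - G z‖ - ‖G (z - (θ, 0)) - G z‖)]
    have e4 : ‖D.Q v γ z‖ * ‖γ z - G (z - (θ, 0))‖ ≤ s * ‖D.Q v γ z‖^2 + s⁻¹ * ‖γ z - G (z - (θ, 0))‖^2 := by
      have := mul_nonneg (inv_nonneg.2 hs0.le) (sq_nonneg (s * ‖D.Q v γ z‖ - ‖γ z - G (z - (θ, 0))‖))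
      have h5 : s⁻¹ * (s * ‖D.Q v γ z‖ - ‖γ z - G (z - (θ, 0))‖)^2 = s * ‖D.Q v γ z‖^2 - 2 * (‖D.Q v γ z‖ * ‖γ z - G (z - (θ, 0))‖) + s⁻¹ * ‖γ z - G (z - (θ, 0))‖^2 := by
        field_simp; ring
      have : 0 ≤ ‖D.Q v γ z‖ * ‖γ z - G (z - (θ, 0))‖ := by positivity
      linarith
    refine e4.trans ?_
    gcongr
  have y2 : ∫ z, (F z * D.P v z - F (z - (θ, 0)) * D.P v z) ≤
      ∫ z, (s * D.P v z ^ 2 + s⁻¹ * ‖F (z - (θ, 0)) - F z‖ ^ 2) := by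
    refine integral_mono (iFP.sub iFP') ((iP.const_mul _).add (iF.const_mul _)) fun z => ?_
    simp only
    rw [Real.norm_eq_abs, sq_abs]
    have := mul_nonneg (inv_nonneg.2 hs0.le) (sq_nonneg (s * D.P v z + (F (z - (θ, 0)) - F z)))
    have h5 : s⁻¹ * (s * D.P v z + (F (z - (θ, 0)) - F z))^2 = s * D.P v z^2 + 2 * (D.P v z * (F (z - (θ, 0)) - F z)) + s⁻¹ * (F (z - (θ, 0)) - F z)^2 := by
      field_simp; ring
    have := mul_nonneg (inv_nonneg.2 hs0.le) (sq_nonneg (s * D.P v z))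
    have := mul_nonneg (inv_nonneg.2 hs0.le) (sq_nonneg (F (z - (θ, 0)) - F z))
    have h6 : s⁻¹ * (s * D.P v z)^2 = s * D.P v z ^2 := by field_simp
    linarith
  have iBA : Integrable (fun z => s⁻¹ * (2 * ‖γ z - G z‖ ^ 2 + 2 * ‖G (z - (θ, 0)) - G z‖ ^ 2)) :=
    (((iB.const_mul _).add (iA.const_mul _)).const_mul _)
  rw [integral_sub iQγ iQG, integral_add (iQ.const_mul _) iBA,
    integral_const_mul, integral_const_mul, integral_add (iB.const_mul _) (iA.const_mul _), integral_const_mul, integral_const_mul] at y1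
  rw [integral_sub iFP iFP', integral_add (iP.const_mul _) (iF.const_mul _), integral_const_mul, integral_const_mul] at y2
  have f1 : s * (∫ z, ‖D.Q v γ z‖ ^ 2) + s * (∫ z, D.P v z ^ 2) ≤ ε / 2 := by
    calc _ ≤ s * C + s * C := by gcongr
      _ ≤ s * (2 * (C + 1)) := by nlinarith
      _ = ε / 2 := by rw [hs]; field_simp; ring
  have f2 : s⁻¹ * (2 * (∫ z, ‖γ z - G z‖ ^ 2) + 2 * ∫ z, ‖G (z - (θ, 0)) - G z‖ ^ 2) + s⁻¹ * (∫ z, ‖F (z - (θ, 0)) - F z‖ ^ 2) ≤ ε / 2 := by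
    calc _ ≤ s⁻¹ * (2 * η + 2 * η) + s⁻¹ * η := by gcongr
      _ = s⁻¹ * (5 * η) := by ring
      _ ≤ s⁻¹ * (5 * (s * ε / 10)) := by gcongr; exact min_le_right _ _
      _ = ε / 2 := by field_simp; ring
  linarith
end TD

def cyl (N : ℕ) (r : ℝ) : Set (ℝ × EN N) := univ ×ˢ Metric.closedBall (0 : EN N) (r+1)

lemma mem_cyl {N : ℕ} {r : ℝ} {z : ℝ × EN N} (h : ‖z.2‖ ≤ r) : z ∈ cyl N r :=
  ⟨mem_univ _, by simp; linarith⟩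

lemma mul_int {N : ℕ} {U : ℝ × EN N → ℝ} (hU : Measurable U) {CU : ℝ} (hUb : ∀ z, |U z| ≤ CU)
    {f : ℝ × EN N → ℝ} (hf : Integrable f) : Integrable fun z => U z * f z :=
  hf.bdd_mul hU.aestronglyMeasurable (ae_of_all _ hUb)

namespace TD
variable {N : ℕ} (D : TD N)

lemma a_eq (T : ℝ) (hT : ∀ t, T ≤ t → D.χ t = 0) {U : ℝ × EN N → ℝ} (hU : Measurable U) {CU : ℝ} (hUb : ∀ z, |U z| ≤ CU)
    (gb G : ℝ × EN N → EN N) (hG : MemLp G 2 volume) (hGd : ∀ z : ℝ × EN N, ‖z.2‖ ≤ D.r → G z = gb z)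
    (fb F : ℝ × EN N → ℝ) (hF : MemLp F 2 volume) (hFd : ∀ z : ℝ × EN N, ‖z.2‖ ≤ D.r → F z = fb z)
    (WE : ∀ ζ : ℝ × EN N → ℝ, ContDiff ℝ 1 ζ → HasCompactSupport ζ → (∀ z : ℝ × EN N, T ≤ z.1 → ζ z = 0) →
      ∫ z, (U z * fderiv ℝ ζ z (1, 0) + fderiv ℝ ζ z (0, gb z) + fb z * ζ z) = 0)
    {v : ℝ × EN N → ℝ} {γ : ℝ × EN N → EN N} (hv : ContDiff ℝ 1 v) (hγ : Continuous γ)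
    (hd : ∀ z, ‖z.2‖ ≤ D.r → ∀ e : EN N, fderiv ℝ v z (0, e) = inner ℝ (γ z) e) (θ : ℝ) (hθ : 0 ≤ θ) :
    ∫ z, U z * fderiv ℝ (D.P v) (z + (θ, 0)) (1, 0) =
      - (∫ z, inner ℝ (D.Q v γ z) (G (z - (θ, 0))))
       - ∫ z, F (z - (θ, 0)) * D.P v z := by
  have hP := D.P_contDiff hv
  have mpp := measurePreserving_add_right (volume : Measure (ℝ × EN N)) (θ, 0)
  have ha : ContDiff ℝ 1 (fun z : ℝ × EN N => D.P v (z + (θ, 0))) :=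
    hP.comp (contDiff_id.add contDiff_const)
  have hb : HasCompactSupport (fun z : ℝ × EN N => D.P v (z + (θ, 0))) :=
    (D.P_hcs v).comp_homeomorph (Homeomorph.addRight ((θ, 0) : ℝ × EN N))
  have w := WE (fun z => D.P v (z + (θ, 0))) ha hb (fun z hz => by
      have : D.χ (z.1 + θ) = 0 := hT _ (by linarith)
      simp [P, this])
  have e : ∀ z, U z * fderiv ℝ (fun z => D.P v (z + (θ, 0))) z (1, 0) + fderiv ℝ (fun z => D.P v (z + (θ, 0))) z (0, gb z)
      + fb z * D.P v (z + (θ, 0)) = U z * fderiv ℝ (D.P v) (z + (θ, 0)) (1, 0) +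
       inner ℝ (D.Q v γ (z + (θ, 0))) (G z) + F z * D.P v (z + (θ, 0)) := by
    intro z
    rw [fderiv_comp_add_right, D.P_deriv hv hd]
    by_cases hz : ‖z.2‖ ≤ D.r
    · rw [hGd z hz, hFd z hz]
    · have : z + (θ, 0) ∉ D.K := fun h => hz (by simpa using D.K_r h)
      simp [D.Q_out v γ this, D.P_out v this]
  simp_rw [e] at w
  have mQ : MemLp (D.Q v γ) 2 volume := (D.Q_cont hv.continuous hγ).memLp_of_hasCompactSupport (D.Q_hcs v γ)
  have mP : MemLp (D.P v) 2 volume := hP.continuous.memLp_of_hasCompactSupport (D.P_hcs v)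
  have mQ' : MemLp (fun z => D.Q v γ (z + (θ, 0))) 2 volume := mQ.comp_measurePreserving mpp
  have mP' : MemLp (fun z => D.P v (z + (θ, 0))) 2 volume := mP.comp_measurePreserving mpp
  have I1 : Integrable fun z => U z * fderiv ℝ (D.P v) (z + (θ, 0)) (1, 0) := by
    refine mul_int hU hUb ?_
    have : Integrable fun z => fderiv ℝ (D.P v) z (1, 0) :=
      ((hP.continuous_fderiv one_ne_zero).clm_apply continuous_const).integrable_of_hasCompactSupport
        ((D.P_hcs v).fderiv_apply ℝ _)
    exact mpp.integrable_comp_of_integrable this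
  have I2 : Integrable fun z => inner ℝ (D.Q v γ (z + (θ, 0))) (G z) := by
    refine (mQ'.norm.integrable_mul hG.norm).mono' (mQ'.1.inner hG.1) (ae_of_all _ fun z => ?_)
    exact norm_inner_le_norm _ _
  have I3 : Integrable fun z => F z * D.P v (z + (θ, 0)) := hF.integrable_mul mP'
  have I12 : Integrable fun z => U z * fderiv ℝ (D.P v) (z + (θ, 0)) (1, 0) + inner ℝ (D.Q v γ (z + (θ, 0))) (G z) := I1.add I2
  rw [integral_add I12 I3, integral_add I1 I2] at w
  have s1 := integral_add_right_eq_self (μ := volume) (fun z => inner ℝ (D.Q v γ z) (G (z - (θ, 0)))) (θ, 0)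
  have s2 := integral_add_right_eq_self (μ := volume) (fun z => F (z - (θ, 0)) * D.P v z) (θ, 0)
  simp only [add_sub_cancel_right] at s1 s2
  rw [← s1, ← s2]
  linarith

lemma b_deriv {U : ℝ × EN N → ℝ} (hU : Measurable U) {CU : ℝ} (hUb : ∀ z, |U z| ≤ CU)
    {v : ℝ × EN N → ℝ} (hv : ContDiff ℝ 1 v) (θ : ℝ) :
    HasDerivAt (fun θ : ℝ => ∫ z, U z * D.P v (z + (θ, 0)))
      (∫ z, U z * fderiv ℝ (D.P v) (z + (θ, 0)) (1, 0)) θ := by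
  have hP := D.P_contDiff hv
  have hc : Continuous fun z => fderiv ℝ (D.P v) z (1, 0) :=
    (hP.continuous_fderiv one_ne_zero).clm_apply continuous_const
  have hs : HasCompactSupport fun z => fderiv ℝ (D.P v) z (1, 0) := (D.P_hcs v).fderiv_apply ℝ _
  obtain ⟨c, hcb⟩ := hs.exists_bound_of_continuous hc
  have hc0 : 0 ≤ c := (norm_nonneg _).trans (hcb 0)
  set S := tsupport fun z => fderiv ℝ (D.P v) z (1, 0)
  have hS : IsCompact S := hs
  set S' : Set (ℝ × EN N) := (fun p : (ℝ × EN N) × ℝ => p.1 - (p.2, 0)) '' (S ×ˢ Metric.closedBall θ 1)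
  have hS' : IsCompact S' := (hS.prod (isCompact_closedBall _ _)).image (by fun_prop)
  have hCU : 0 ≤ CU := (abs_nonneg _).trans (hUb 0)
  have I : ∀ θ : ℝ, Integrable fun z => D.P v (z + (θ, 0)) := fun θ =>
    (measurePreserving_add_right (volume : Measure (ℝ × EN N)) (θ, 0)).integrable_comp_of_integrable
      (hP.continuous.integrable_of_hasCompactSupport (D.P_hcs v))
  refine (hasDerivAt_integral_of_dominated_loc_of_deriv_le (s := Metric.ball θ 1)
    (F := fun (θ : ℝ) z => U z * D.P v (z + (θ, 0)))
    (F' := fun (θ : ℝ) z => U z * fderiv ℝ (D.P v) (z + (θ, 0)) (1, 0))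
    (bound := S'.indicator fun _ => CU * c) (Metric.ball_mem_nhds θ one_pos) ?_ ?_ ?_ ?_ ?_ ?_).2
  · exact Eventually.of_forall fun θ => (mul_int hU hUb (I θ)).1
  · exact mul_int hU hUb (I θ)
  · exact hU.aestronglyMeasurable.mul (hc.comp (by fun_prop : Continuous fun z : ℝ × EN N => z + (θ, 0))).aestronglyMeasurable
  · refine ae_of_all _ fun z x hx => ?_
    by_cases hz : z ∈ S'
    · rw [indicator_of_mem hz, norm_mul]
      exact mul_le_mul (hUb z) (hcb _) (norm_nonneg _) hCU
    · rw [indicator_of_notMem hz]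
      have : z + (x, 0) ∉ S := fun h => hz ⟨(z + (x, 0), x), ⟨h, Metric.ball_subset_closedBall hx⟩, by simp⟩
      rw [image_eq_zero_of_notMem_tsupport this]
      simp
  · exact (integrable_indicator_iff hS'.isClosed.measurableSet).2 (integrableOn_const hS'.measure_lt_top.ne)
  · refine ae_of_all _ fun z x _ => ?_
    have h1 : HasDerivAt (fun θ : ℝ => z + (θ, (0 : EN N))) (1, 0) x :=
      ((hasDerivAt_id x).prodMk (hasDerivAt_const x (0 : EN N))).const_add z
    have h2 := (hP.differentiable one_ne_zero (z + (x, 0))).hasFDerivAt.comp_hasDerivAt x h1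
    exact h2.const_mul (U z)

lemma L4 {U : ℝ × EN N → ℝ} (hU : Measurable U) {CU : ℝ} (hUb : ∀ z, |U z| ≤ CU)
    {v : ℝ × EN N → ℝ} (hv : ContDiff ℝ 1 v) (δ RR : ℝ)
    (hR : ∀ θ : ℝ, 0 ≤ θ → θ < δ → ∫ z, U z * fderiv ℝ (D.P v) (z + (θ, 0)) (1, 0) ≤ RR)
    (h : ℝ) (h0 : 0 ≤ h) (hδ : h < δ) :
    (∫ z, U z * D.P v (z + (h, 0))) - ∫ z, U z * D.P v z ≤ RR * h := by
  have := Convex.image_sub_le_mul_sub_of_deriv_le (convex_Ico 0 δ)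
    (f := fun θ : ℝ => ∫ z, U z * D.P v (z + (θ, 0)))
    (fun θ _ => (D.b_deriv hU hUb hv θ).continuousAt.continuousWithinAt)
    (fun θ _ => (D.b_deriv hU hUb hv θ).differentiableAt.differentiableWithinAt) (C := RR)
    (fun θ hθ => by
      rw [(D.b_deriv hU hUb hv θ).deriv]
      have := interior_subset hθ
      exact hR θ this.1 this.2) 0 ⟨le_rfl, h0.trans_lt hδ⟩ h ⟨h0, hδ⟩ h0
  have e : ((0:ℝ), (0 : EN N)) = 0 := rfl
  simpa [e] using this

end TD

namespace TD
variable {N : ℕ} (D : TD N)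

lemma dvg_out {x : EN N} (h : D.r < ‖x‖) : dvg D.Wφ x = 0 := by
  have e0 : D.Wφ =ᶠ[𝓝 x] fun _ => 0 := by
    have : ∀ᶠ y : EN N in 𝓝 x, D.r < ‖y‖ := (continuous_norm.tendsto x).eventually (eventually_gt_nhds h)
    filter_upwards [this] with y hy
    exact D.Wφr _ hy
  unfold dvg
  rw [e0.fderiv_eq]
  simp

lemma dct {w : ℝ × EN N → ℝ} (hw : AEStronglyMeasurable w volume) (hwi : IntegrableOn w D.K)
    {f : ℕ → ℝ × EN N → ℝ} {f' : ℝ × EN N → ℝ} (hf : ∀ n, AEStronglyMeasurable (f n) volume) (c : ℝ)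
    (hb : ∀ n z, |f n z| ≤ D.K.indicator (fun _ => c) z)
    (hl : ∀ᵐ z, Tendsto (fun n => f n z) atTop (𝓝 (f' z))) :
    Tendsto (fun n => ∫ z, w z * f n z) atTop (𝓝 (∫ z, w z * f' z)) := by
  have hKm : MeasurableSet D.K := D.K_compact.isClosed.measurableSet
  have hi : Integrable fun z => ‖D.K.indicator w z‖ * c := ((integrable_indicator_iff hKm).2 hwi).norm.mul_const c
  refine tendsto_integral_of_dominated_convergence _ (fun n => hw.mul (hf n)) hi (fun n => ae_of_all _ fun z => ?_) ?_
  · have := hb n z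
    rw [norm_mul, Real.norm_eq_abs (f n z)]
    by_cases hz : z ∈ D.K
    · rw [indicator_of_mem hz] at this ⊢
      gcongr
    · rw [indicator_of_notMem hz] at this ⊢
      have h0 : |f n z| = 0 := le_antisymm this (abs_nonneg _)
      simp [h0]
  · filter_upwards [hl] with z hz
    exact hz.const_mul _

lemma L5 (T : ℝ) (hT : ∀ t, T ≤ t → D.χ t = 0) {U : ℝ × EN N → ℝ} (hU : Measurable U) {CU : ℝ} (hUb : ∀ z, |U z| ≤ CU)
    (gb G : ℝ × EN N → EN N) (hG : MemLp G 2 volume)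
    (hGe : G = indicator (univ ×ˢ Metric.closedBall (0 : EN N) (D.r+1)) gb)
    (fb F : ℝ × EN N → ℝ) (hF : MemLp F 2 volume) (hFd : ∀ z : ℝ × EN N, ‖z.2‖ ≤ D.r → F z = fb z)
    (WE : ∀ ζ : ℝ × EN N → ℝ, ContDiff ℝ 1 ζ → HasCompactSupport ζ → (∀ z : ℝ × EN N, T ≤ z.1 → ζ z = 0) →
      ∫ z, (U z * fderiv ℝ ζ z (1, 0) + fderiv ℝ ζ z (0, gb z) + fb z * ζ z) = 0)
    (M : ℝ) (vb : ℝ × EN N → ℝ) (hvb : Measurable vb) (hv0 : ∀ z, 0 ≤ vb z) (hvM : ∀ z, vb z ≤ M)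
    (hw : ∀ ζ : ℝ × EN N → ℝ, ContDiff ℝ 1 ζ → HasCompactSupport ζ → ∀ i : Fin N,
      ∫ z, vb z * fderiv ℝ ζ z (0, EuclideanSpace.single i 1) = - ∫ z, gb z i * ζ z)
    (ε : ℝ) (hε : 0 < ε) :
    ∃ δ > 0, ∀ h : ℝ, 0 ≤ h → h < δ →
      (∫ z, U z * D.P vb (z + (h, 0))) - ∫ z, U z * D.P vb z ≤
        ((∫ z : ℝ × EN N, D.χ z.1 * dvg D.Wφ z.2 * D.Jv vb z) + (∫ z : ℝ × EN N, dvg D.W z.2 * D.P vb z)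
        - (∫ z, F z * D.P vb z) + ε) * h := by
  have hM : 0 ≤ M := (hv0 0).trans (hvM 0)
  obtain ⟨η, hη, δ, hδ, H⟩ := D.L3 M hM G hG F hF ε hε
  obtain ⟨vn, gn, c1, c2, c3, c4, c5, c6⟩ := mollify N D.r M vb hvb hv0 hvM gb (hGe ▸ hG) hw
  rw [← hGe] at c6
  have hGd : ∀ z : ℝ × EN N, ‖z.2‖ ≤ D.r → G z = gb z := fun z hz => by
    rw [hGe]; exact indicator_of_mem (mem_cyl hz) _
  refine ⟨δ, hδ, fun h h0 hhδ => ?_⟩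
  have ev : ∀ᶠ n in atTop, ∫⁻ z, ‖gn n z - G z‖ₑ ^ 2 ≤ ENNReal.ofReal η := by
    have := c6.eventually (eventually_lt_nhds (b := ENNReal.ofReal η) (by simpa using hη))
    filter_upwards [this] with n hn using hn.le
  obtain ⟨c, hc0, h1, h2, h3, h4, h5, h6⟩ := D.bounds
  have hKm : MeasurableSet D.K := D.K_compact.isClosed.measurableSet
  have cV := D.hV.continuous
  have lP : ∀ᵐ z, Tendsto (fun n => D.P (vn n) z) atTop (𝓝 (D.P vb z)) := by
    filter_upwards [c3] with z hz
    unfold P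
    exact (((hz.sub_const _).max tendsto_const_nhds).pow 2).const_mul _
  have lJ : ∀ᵐ z, Tendsto (fun n => D.K.indicator (D.Jv (vn n)) z) atTop (𝓝 (D.K.indicator (D.Jv vb) z)) := by
    filter_upwards [c3] with z hz
    by_cases hzK : z ∈ D.K
    · simp only [indicator_of_mem hzK]
      unfold Jv
      exact (((hz.sub_const _).max tendsto_const_nhds).pow 3).div_const _
    · simp only [indicator_of_notMem hzK]; exact tendsto_const_nhds
  have bP : ∀ n z, |D.P (vn n) z| ≤ D.K.indicator (fun _ => c * c * M ^ 2) z := fun n z => by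
    rw [abs_of_nonneg (D.P_nonneg _ _)]
    exact D.P_le hc0 h1 h2 _ z (c2 n z)
  have bJ : ∀ n z, |D.K.indicator (D.Jv (vn n)) z| ≤ D.K.indicator (fun _ => M ^ 3 / 3) z := fun n z => by
    by_cases hzK : z ∈ D.K
    · simp only [indicator_of_mem hzK]
      unfold Jv
      have hm : max (vn n z - D.V z.2) 0 ≤ M := max_le (by linarith [D.V0 z.2, c2 n z]) hM
      rw [abs_of_nonneg (by positivity)]
      gcongr
    · simp [hzK]
  have mP : ∀ n, AEStronglyMeasurable (D.P (vn n)) volume := fun n => (D.P_contDiff (c1 n)).continuous.aestronglyMeasurable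
  have mJ : ∀ n, AEStronglyMeasurable (D.K.indicator (D.Jv (vn n))) volume := fun n =>
    (D.Jv_contDiff (c1 n)).continuous.aestronglyMeasurable.indicator hKm
  have tF := D.dct hF.1 ((hF.locallyIntegrable (by norm_num)).integrableOn_isCompact D.K_compact) mP _ bP lP
  have cW : Continuous fun z : ℝ × EN N => dvg D.W z.2 := (continuous_dvg D.hW).comp continuous_snd
  have tW := D.dct cW.aestronglyMeasurable (cW.continuousOn.integrableOn_compact D.K_compact) mP _ bP lP
  have cφ : Continuous fun z : ℝ × EN N => D.χ z.1 * dvg D.Wφ z.2 :=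
    (D.hχ.continuous.comp continuous_fst).mul ((continuous_dvg D.hWφ).comp continuous_snd)
  have tJ := D.dct cφ.aestronglyMeasurable (cφ.continuousOn.integrableOn_compact D.K_compact) mJ _ bJ lJ
  have eJ : ∀ v, (fun z : ℝ × EN N => D.χ z.1 * dvg D.Wφ z.2 * D.K.indicator (D.Jv v) z) =
      fun z => D.χ z.1 * dvg D.Wφ z.2 * D.Jv v z := by
    intro v; ext z
    by_cases hzK : z ∈ D.K
    · simp only [indicator_of_mem hzK]
    · rcases D.χ_out hzK with h | h
      · simp [h]
      · simp [D.dvg_out h]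
  simp_rw [eJ] at tJ
  have tU : ∀ h : ℝ, Tendsto (fun n => ∫ z, U z * D.P (vn n) (z + (h, 0))) atTop (𝓝 (∫ z, U z * D.P vb (z + (h, 0)))) := by
    intro h
    have hUm : Measurable fun z : ℝ × EN N => U (z - (h, 0)) := hU.comp (by fun_prop)
    have hUi : IntegrableOn (fun z : ℝ × EN N => U (z - (h, 0))) D.K :=
      Measure.integrableOn_of_bounded (M := CU) D.K_compact.measure_lt_top.ne hUm.aestronglyMeasurable (ae_of_all _ fun z => hUb _)
    have := D.dct hUm.aestronglyMeasurable hUi mP _ bP lP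
    have e : ∀ v, ∫ z, U z * D.P v (z + (h, 0)) = ∫ z, U (z - (h, 0)) * D.P v z := fun v => by
      rw [← integral_add_right_eq_self (μ := volume) (fun z => U (z - (h, 0)) * D.P v z) (h, 0)]
      simp
    simp_rw [e]
    exact this
  have tU0 := tU 0
  have e : ((0:ℝ), (0 : EN N)) = 0 := rfl
  simp only [e, add_zero] at tU0
  refine le_of_tendsto_of_tendsto ((tU h).sub tU0) ((((tJ.add tW).sub tF).add_const ε).mul_const h) ?_
  filter_upwards [ev] with n hn
  refine D.L4 hU hUb (c1 n) δ _ (fun θ hθ0 hθδ => ?_) h h0 hhδ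
  rw [D.a_eq T hT hU hUb gb G hG hGd fb F hF hFd WE (c1 n) (c4 n) (c5 n) θ hθ0]
  exact H (vn n) (gn n) (c1 n) (c4 n) (c5 n) (c2 n) hn θ (by rwa [abs_of_nonneg hθ0])
end TD

def PhiF (m V r : ℝ) : ℝ := ∫ s in (0:ℝ)..r, (max (s ^ m - V) 0) ^ 2

lemma PhiF_integrand_cont {m : ℝ} (hm : 1 < m) (V : ℝ) : Continuous fun s : ℝ => (max (s ^ m - V) 0) ^ 2 := by
  have : Continuous fun s : ℝ => s ^ m := Real.continuous_rpow_const (by linarith)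
  fun_prop

lemma PhiF_cont {m : ℝ} (hm : 1 < m) : Continuous fun p : ℝ × ℝ => PhiF m p.1 p.2 := by
  unfold PhiF
  refine intervalIntegral.continuous_parametric_intervalIntegral_of_continuous ?_ continuous_snd
  have : Continuous fun s : ℝ => s ^ m := Real.continuous_rpow_const (by linarith)
  fun_prop

lemma PhiF_mono_integrand {m : ℝ} (hm : 1 < m) (V : ℝ) {s t : ℝ} (hs : 0 ≤ s) (hst : s ≤ t) :
    (max (s ^ m - V) 0) ^ 2 ≤ (max (t ^ m - V) 0) ^ 2 := by
  gcongr

lemma PhiF_conv {m : ℝ} (hm : 1 < m) (V : ℝ) {a b : ℝ} (ha : 0 ≤ a) (hb : 0 ≤ b) :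
    PhiF m V b - PhiF m V a ≤ (b - a) * (max (b ^ m - V) 0) ^ 2 := by
  have hc := PhiF_integrand_cont hm V
  unfold PhiF
  rw [intervalIntegral.integral_interval_sub_left (μ := volume) (hc.intervalIntegrable _ _) (hc.intervalIntegrable _ _)]
  rcases le_total a b with h | h
  · have := intervalIntegral.integral_mono_on (μ := volume) h (hc.intervalIntegrable a b) ((continuous_const (y := (max (b ^ m - V) 0) ^ 2)).intervalIntegrable _ _)
      (fun s hs => PhiF_mono_integrand hm V (ha.trans hs.1) hs.2)
    simpa using this
  · rw [intervalIntegral.integral_symm]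
    have := intervalIntegral.integral_mono_on (μ := volume) h ((continuous_const (y := (max (b ^ m - V) 0) ^ 2)).intervalIntegrable _ _) (hc.intervalIntegrable b a) 
      (fun s hs => PhiF_mono_integrand hm V hb hs.1)
    simp at this
    linarith

lemma PhiF_nonneg (m V : ℝ) {r : ℝ} (hr : 0 ≤ r) : 0 ≤ PhiF m V r :=
  intervalIntegral.integral_nonneg hr fun s _ => by positivity

lemma PhiF_zero (m V : ℝ) : PhiF m V 0 = 0 := by simp [PhiF]

lemma PhiF_eq_zero {m : ℝ} (hm : 1 < m) {V r : ℝ} (hr : 0 ≤ r) (h : r ^ m ≤ V) : PhiF m V r = 0 := by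
  refine le_antisymm ?_ (PhiF_nonneg m V hr)
  have := PhiF_conv hm V le_rfl hr
  rw [PhiF_zero, max_eq_right (by linarith)] at this
  simpa using this

lemma PhiF_le {m : ℝ} (hm : 1 < m) {V r C : ℝ} (hV : 0 ≤ V) (hr : 0 ≤ r) (hC : r ≤ C) :
    PhiF m V r ≤ C * (C ^ m) ^ 2 := by
  have := PhiF_conv hm V le_rfl hr
  rw [PhiF_zero, sub_zero, sub_zero] at this
  refine this.trans ?_
  have hC0 := hr.trans hC
  have h1 : max (r ^ m - V) 0 ≤ C ^ m := max_le (by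
    have : r ^ m ≤ C ^ m := by gcongr
    linarith) (by positivity)
  gcongr

lemma J_le_Phi {m : ℝ} (hm : 1 < m) {V r C : ℝ} (hr : 0 ≤ r) (hC : r ≤ C) (hV : 0 ≤ V) :
    (max (r ^ m - V) 0) ^ 3 / 3 ≤ m * C ^ (m - 1) * PhiF m V r := by
  have hd1 : ∀ s, HasDerivAt (PhiF m V) ((max (s ^ m - V) 0) ^ 2) s := fun s =>
    (PhiF_integrand_cont hm V).integral_hasStrictDerivAt 0 s |>.hasDerivAt
  have hd2 : ∀ s, HasDerivAt (fun s : ℝ => (max (s ^ m - V) 0) ^ 3 / 3) ((max (s ^ m - V) 0) ^ 2 * (m * s ^ (m - 1))) s := by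
    intro s
    have h1 : HasDerivAt (fun s : ℝ => s ^ m - V) (m * s ^ (m - 1)) s := by
      have := (Real.hasDerivAt_rpow_const (x := s) (p := m) (Or.inr hm.le)).sub_const V
      simpa using this
    have h2 := ((hasDerivAt_pospow 1 (s ^ m - V)).comp s h1).div_const 3
    have e : ((1:ℕ) + 2 : ℝ) * max (s ^ m - V) 0 ^ (1 + 1) * (m * s ^ (m - 1)) / 3 = max (s ^ m - V) 0 ^ 2 * (m * s ^ (m - 1)) := by
      push_cast
      ring
    rw [e] at h2
    exact h2
  have hmono : MonotoneOn (fun s => m * C ^ (m - 1) * PhiF m V s - (max (s ^ m - V) 0) ^ 3 / 3) (Icc 0 C) := by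
    have hD : ∀ s, HasDerivAt (fun s => m * C ^ (m - 1) * PhiF m V s - (max (s ^ m - V) 0) ^ 3 / 3)
      (m * C ^ (m - 1) * (max (s ^ m - V) 0) ^ 2 - (max (s ^ m - V) 0) ^ 2 * (m * s ^ (m - 1))) s := fun s =>
      ((hd1 s).const_mul _).sub (hd2 s)
    refine monotoneOn_of_deriv_nonneg (convex_Icc 0 C) (fun s _ => (hD s).continuousAt.continuousWithinAt)
      (fun s _ => (hD s).differentiableAt.differentiableWithinAt) fun s hs => ?_
    rw [(hD s).deriv]
    have hs' := interior_subset hs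
    have : s ^ (m - 1) ≤ C ^ (m - 1) := Real.rpow_le_rpow hs'.1 hs'.2 (by linarith)
    have h0 : 0 ≤ (max (s ^ m - V) 0) ^ 2 * m := by positivity
    nlinarith
  have := hmono ⟨le_rfl, hr.trans hC⟩ ⟨hr, hC⟩ hr
  simp only [PhiF_zero, Real.zero_rpow (by linarith : m ≠ 0)] at this
  rw [max_eq_right (by linarith : 0 - V ≤ 0)] at this
  norm_num at this
  linarith

def slab (N : ℕ) (T : ℝ) : Set (ℝ × EN N) := Ioo 0 T ×ˢ univ

lemma slab_meas (N : ℕ) (T : ℝ) : MeasurableSet (slab N T) := measurableSet_Ioo.prod MeasurableSet.univ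

lemma mem_slab {N : ℕ} {T : ℝ} {z : ℝ × EN N} : z ∈ slab N T ↔ 0 < z.1 ∧ z.1 < T := by
  simp [slab]

def vbar (N : ℕ) (T m : ℝ) (u : ℝ → EN N → ℝ) : ℝ × EN N → ℝ :=
  (slab N T).indicator fun z => u z.1 z.2 ^ m
def Ubar (N : ℕ) (T : ℝ) (u0 : EN N → ℝ) (u : ℝ → EN N → ℝ) : ℝ × EN N → ℝ :=
  (slab N T).indicator fun z => u0 z.2 - u z.1 z.2
def fbar (N : ℕ) (T q : ℝ) (w : EN N → ℝ) (u : ℝ → EN N → ℝ) : ℝ × EN N → ℝ :=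
  (slab N T).indicator fun z => w z.2 * u z.1 z.2 ^ q
def Psi (N : ℕ) (T m : ℝ) (φ V : EN N → ℝ) (u : ℝ → EN N → ℝ) : ℝ × EN N → ℝ :=
  (slab N T).indicator fun z => φ z.2 * PhiF m (V z.2) (u z.1 z.2)

lemma Psi_nonneg {N : ℕ} {T m : ℝ} {φ V : EN N → ℝ} (hφ : ∀ x, 0 ≤ φ x) {u : ℝ → EN N → ℝ} (hu : ∀ t x, 0 ≤ u t x) (z) :
    0 ≤ Psi N T m φ V u z :=
  indicator_nonneg (fun z _ => mul_nonneg (hφ _) (PhiF_nonneg _ _ (hu _ _))) z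

lemma Psi_meas {N : ℕ} {T m : ℝ} (hm : 1 < m) {φ V : EN N → ℝ} (hφ : Continuous φ) (hV : Continuous V)
    {u : ℝ → EN N → ℝ} (hu : Measurable (Function.uncurry u)) : Measurable (Psi N T m φ V u) := by
  refine Measurable.indicator ?_ (slab_meas N T)
  have h1 : Measurable fun z : ℝ × EN N => (V z.2, u z.1 z.2) := (hV.measurable.comp measurable_snd).prodMk hu
  exact (hφ.measurable.comp measurable_snd).mul ((PhiF_cont hm).measurable.comp h1)

lemma Psi_le {N : ℕ} {T m : ℝ} (hm : 1 < m) {φ V : EN N → ℝ} (hφ : ∀ x, 0 ≤ φ x) (hV : ∀ x, 0 ≤ V x)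
    {u : ℝ → EN N → ℝ} (hu0 : ∀ t x, 0 ≤ u t x) {C : ℝ} (huC : ∀ t x, u t x ≤ C) (r c : ℝ)
    (hφc : ∀ x, φ x ≤ c) (hφr : ∀ x, r < ‖x‖ → φ x = 0) (z : ℝ × EN N) :
    Psi N T m φ V u z ≤ (Ioo 0 T ×ˢ Metric.closedBall (0 : EN N) r).indicator (fun _ => c * (C * (C ^ m) ^ 2)) z := by
  have hC : 0 ≤ C := (hu0 0 0).trans (huC 0 0)
  unfold Psi
  by_cases h1 : z ∈ slab N T
  · rw [indicator_of_mem h1]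
    by_cases h2 : r < ‖z.2‖
    · rw [hφr _ h2, indicator_of_notMem (fun h => absurd h.2 (by simpa using h2))]; simp
    · have h4 : z ∈ Ioo 0 T ×ˢ Metric.closedBall (0 : EN N) r := ⟨h1.1, by simpa using h2⟩
      rw [indicator_of_mem h4]
      have := PhiF_le hm (hV z.2) (hu0 z.1 z.2) (huC z.1 z.2)
      have h3 := PhiF_nonneg m (V z.2) (hu0 z.1 z.2)
      have := hφ z.2
      have := hφc z.2
      have : 0 ≤ C * (C ^ m) ^ 2 := by positivity
      gcongr
      linarith
  · rw [indicator_of_notMem h1, indicator_of_notMem (fun h => h1 ⟨h.1, mem_univ _⟩)]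

lemma Psi_int {N : ℕ} {T m : ℝ} (hm : 1 < m) {φ V : EN N → ℝ} (hφ : Continuous φ) (hV : Continuous V)
    (hφ0 : ∀ x, 0 ≤ φ x) (hV0 : ∀ x, 0 ≤ V x)
    {u : ℝ → EN N → ℝ} (hu : Measurable (Function.uncurry u)) (hu0 : ∀ t x, 0 ≤ u t x) {C : ℝ} (huC : ∀ t x, u t x ≤ C) (r c : ℝ)
    (hφc : ∀ x, φ x ≤ c) (hφr : ∀ x, r < ‖x‖ → φ x = 0) : Integrable (Psi N T m φ V u) := by
  have hm1 : MeasurableSet (Ioo 0 T ×ˢ Metric.closedBall (0 : EN N) r) := measurableSet_Ioo.prod Metric.isClosed_closedBall.measurableSet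
  have hfin : volume (Ioo 0 T ×ˢ Metric.closedBall (0 : EN N) r) ≠ ⊤ := by
    rw [Measure.volume_eq_prod, Measure.prod_prod]
    exact ENNReal.mul_ne_top (by simp) (isCompact_closedBall _ _).measure_lt_top.ne
  have : Integrable ((Ioo 0 T ×ˢ Metric.closedBall (0 : EN N) r).indicator (fun _ => c * (C * (C ^ m) ^ 2))) :=
    (integrable_indicator_iff hm1).2 (integrableOn_const hfin)
  refine this.mono' (Psi_meas hm hφ hV hu).aestronglyMeasurable (ae_of_all _ fun z => ?_)
  rw [Real.norm_of_nonneg (Psi_nonneg hφ0 hu0 z)]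
  exact Psi_le hm hφ0 hV0 hu0 huC r c hφc hφr z

namespace TD
variable {N : ℕ} (D : TD N)

lemma L6 (T : ℝ) (hT : ∀ t, T ≤ t → D.χ t = 0) {m q : ℝ} (hm : 1 < m) {w : EN N → ℝ} 
    {u0 : EN N → ℝ} {u : ℝ → EN N → ℝ} (hu0 : Measurable u0) (hu : Measurable (Function.uncurry u)) {C : ℝ}
    (hu00 : ∀ x, 0 ≤ u0 x) (hu0C : ∀ x, u0 x ≤ C) (hun : ∀ t x, 0 ≤ u t x) (huC : ∀ t x, u t x ≤ C)
    (gb G : ℝ × EN N → EN N) (hG : MemLp G 2 volume)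
    (hGe : G = indicator (univ ×ˢ Metric.closedBall (0 : EN N) (D.r+1)) gb)
    (F : ℝ × EN N → ℝ) (hF : MemLp F 2 volume) (hFd : ∀ z : ℝ × EN N, ‖z.2‖ ≤ D.r → F z = fbar N T q w u z)
    (WE : ∀ ζ : ℝ × EN N → ℝ, ContDiff ℝ 1 ζ → HasCompactSupport ζ → (∀ z : ℝ × EN N, T ≤ z.1 → ζ z = 0) →
      ∫ z, (Ubar N T u0 u z * fderiv ℝ ζ z (1, 0) + fderiv ℝ ζ z (0, gb z) + fbar N T q w u z * ζ z) = 0)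
    (hw : ∀ ζ : ℝ × EN N → ℝ, ContDiff ℝ 1 ζ → HasCompactSupport ζ → ∀ i : Fin N,
      ∫ z, vbar N T m u z * fderiv ℝ ζ z (0, EuclideanSpace.single i 1) = - ∫ z, gb z i * ζ z)
    (l : ℝ) (hl : ∀ t, 0 < t → t < T → ∀ h, 0 ≤ h → h * l * D.χ (t + h) ≤ D.χ t - D.χ (t + h))
    (hu0V : ∀ᵐ x, u0 x ^ m ≤ D.V x)
    (hH : ∀ᵐ z : ℝ × EN N, 0 < z.1 → D.V z.2 < u z.1 z.2 ^ m → dvg D.W z.2 ≤ w z.2 * u z.1 z.2 ^ q) :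
    l * ∫ z, D.χ z.1 * Psi N T m D.φ D.V u z ≤
      ∫ z : ℝ × EN N, D.χ z.1 * dvg D.Wφ z.2 * D.Jv (vbar N T m u) z := by
  have hC : 0 ≤ C := (hun 0 0).trans (huC 0 0)
  obtain ⟨c, hc0, h1, h2, h3, h4, h5, h6⟩ := D.bounds
  set Ψ := Psi N T m D.φ D.V u with hΨ
  have hΨ0 : ∀ z, 0 ≤ Ψ z := Psi_nonneg D.φ0 hun
  have hΨi : Integrable Ψ := Psi_int hm D.hφ.continuous D.hV.continuous D.φ0 D.V0 hu hun huC D.r c h2 D.φr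
  set U := Ubar N T u0 u with hUdef
  set v := vbar N T m u with hvdef
  have hUm : Measurable U := ((hu0.comp measurable_snd).sub hu).indicator (slab_meas N T)
  have hUb : ∀ z, |U z| ≤ C := by
    intro z
    rw [hUdef]; unfold Ubar
    by_cases hz : z ∈ slab N T
    · rw [indicator_of_mem hz, abs_le]
      constructor <;> linarith [hu00 z.2, hu0C z.2, hun z.1 z.2, huC z.1 z.2]
    · simpa [hz] using hC
  have hvm : Measurable v := by
    refine Measurable.indicator ?_ (slab_meas N T)
    exact (hu.pow_const m)
  have hv0 : ∀ z, 0 ≤ v z := indicator_nonneg fun z _ => Real.rpow_nonneg (hun _ _) _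
  have hvM : ∀ z, v z ≤ C ^ m := by
    intro z
    rw [hvdef]; unfold vbar
    by_cases hz : z ∈ slab N T
    · rw [indicator_of_mem hz]
      exact Real.rpow_le_rpow (hun _ _) (huC _ _) (by linarith)
    · rw [indicator_of_notMem hz]; positivity
  have hPm : Measurable (D.P v) := by
    have := D.hχ.continuous.measurable
    have := D.hφ.continuous.measurable
    have := D.hV.continuous.measurable
    unfold P
    fun_prop
  have hKm : MeasurableSet D.K := D.K_compact.isClosed.measurableSet
  have hPi : Integrable (D.P v) := by
    refine Integrable.mono' ((integrable_indicator_iff hKm).2 (integrableOn_const (C := c * c * (C ^ m) ^ 2) D.K_compact.measure_lt_top.ne)) hPm.aestronglyMeasurable (ae_of_all _ fun z => ?_)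
    rw [Real.norm_of_nonneg (D.P_nonneg _ _)]
    exact D.P_le hc0 h1 h2 _ z ⟨hv0 z, hvM z⟩
  have hPs : ∀ z, z ∉ slab N T → D.P v z = 0 := by
    intro z hz
    have : v z = 0 := indicator_of_notMem hz _
    unfold P
    rw [this, max_eq_right (by linarith [D.V0 z.2])]
    simp
  have hχm := D.hχ.continuous
  have hχΨ : ∀ h : ℝ, Integrable fun z : ℝ × EN N => D.χ (z.1 + h) * Ψ z := fun h =>
    hΨi.bdd_mul (c := c) (by fun_prop : Continuous fun z : ℝ × EN N => D.χ (z.1 + h)).aestronglyMeasurable (ae_of_all _ fun z => by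
      rw [Real.norm_of_nonneg (D.χ0 _)]; exact h1 _)
  -- reaction term
  have hFP : (∫ z : ℝ × EN N, dvg D.W z.2 * D.P v z) ≤ ∫ z, F z * D.P v z := by
    have mP : MemLp (D.P v) 2 volume := by
      refine MemLp.of_le (g := D.K.indicator fun _ => c * c * (C ^ m) ^ 2) (memLp_indicator_const 2 hKm _ (Or.inr D.K_compact.measure_lt_top.ne)) hPm.aestronglyMeasurable (ae_of_all _ fun z => ?_)
      rw [Real.norm_of_nonneg (D.P_nonneg _ _)]
      exact (D.P_le hc0 h1 h2 _ z ⟨hv0 z, hvM z⟩).trans (le_abs_self _)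
    refine integral_mono_ae ?_ (hF.integrable_mul mP) ?_
    · refine Integrable.mono' (hPi.const_mul c) ((((continuous_dvg D.hW).comp continuous_snd).aestronglyMeasurable).mul hPm.aestronglyMeasurable) (ae_of_all _ fun z => ?_)
      by_cases hz : z ∈ D.K
      · rw [Real.norm_eq_abs, abs_mul, abs_of_nonneg (D.P_nonneg v z)]
        exact mul_le_mul_of_nonneg_right (h5 _ (D.K_r hz)) (D.P_nonneg v z)
      · simp [D.P_out v hz]
    · filter_upwards [hH] with z hz
      by_cases hzK : z ∈ D.K
      · by_cases hzs : z ∈ slab N T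
        · by_cases hV : D.V z.2 < u z.1 z.2 ^ m
          · have := hz (mem_slab.1 hzs).1 hV
            rw [hFd z (D.K_r hzK)]
            unfold fbar
            rw [indicator_of_mem hzs]
            exact mul_le_mul_of_nonneg_right this (D.P_nonneg v z)
          · have hvz : v z = u z.1 z.2 ^ m := indicator_of_mem hzs _
            have : D.P v z = 0 := by
              unfold P
              rw [hvz, max_eq_right (by linarith)]
              simp
            simp [this]
        · simp [hPs z hzs]
      · simp [D.P_out v hzK]
  -- time term
  have hu0V' : ∀ᵐ z : ℝ × EN N, u0 z.2 ^ m ≤ D.V z.2 := Measure.quasiMeasurePreserving_snd.ae hu0V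
  have key : ∀ h : ℝ, 0 < h → h * (l * ∫ z : ℝ × EN N, D.χ (z.1 + h) * Ψ z) ≤
      (∫ z, U z * D.P v (z + (h, 0))) - ∫ z, U z * D.P v z := by
    intro h hh
    have e1 : ∫ z, U z * D.P v (z + (h, 0)) = ∫ z, U (z - (h, 0)) * D.P v z := by
      rw [← integral_add_right_eq_self (μ := volume) (fun z => U (z - (h, 0)) * D.P v z) (h, 0)]
      simp
    have e2 : ∫ z : ℝ × EN N, D.χ (z.1 + h) * Ψ z = ∫ z : ℝ × EN N, D.χ z.1 * Ψ (z - (h, 0)) := by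
      rw [← integral_add_right_eq_self (μ := volume) (fun z : ℝ × EN N => D.χ z.1 * Ψ (z - (h, 0))) (h, 0)]
      simp
    have I2 : Integrable fun z : ℝ × EN N => D.χ z.1 * Ψ (z - (h, 0)) := by
      have := (measurePreserving_sub_right (volume : Measure (ℝ × EN N)) (h, 0)).integrable_comp_of_integrable (hχΨ h)
      simpa [Function.comp_def] using this
    have I1 : Integrable fun z : ℝ × EN N => D.χ z.1 * Ψ z := by simpa using hχΨ 0
    have hUm' : Measurable fun z : ℝ × EN N => U (z - (h, 0)) := hUm.comp (by fun_prop)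
    have J1 := mul_int hUm hUb hPi
    have J2 : Integrable fun z => U (z - (h, 0)) * D.P v z := mul_int hUm' (fun z => hUb _) hPi
    have s1 : ∫ z : ℝ × EN N, (D.χ z.1 * Ψ z - D.χ z.1 * Ψ (z - (h, 0))) ≤ ∫ z, (U (z - (h, 0)) * D.P v z - U z * D.P v z) := by
      refine integral_mono_ae (I1.sub I2) (J2.sub J1) ?_
      filter_upwards [hu0V'] with z hz
      by_cases hzs : z ∈ slab N T
      · have hvz : v z = u z.1 z.2 ^ m := indicator_of_mem hzs _
        have hUz : U z = u0 z.2 - u z.1 z.2 := indicator_of_mem hzs _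
        have hΨz : Ψ z = D.φ z.2 * PhiF m (D.V z.2) (u z.1 z.2) := indicator_of_mem hzs _
        have hcf : 0 ≤ D.χ z.1 * D.φ z.2 := mul_nonneg (D.χ0 _) (D.φ0 _)
        obtain ⟨b1, b2⟩ := mem_slab.1 hzs
        by_cases hth : h < z.1
        · have hzs' : z - (h, 0) ∈ slab N T := mem_slab.2 ⟨by simpa using hth, by simp; linarith⟩
          have hUz' : U (z - (h, 0)) = u0 z.2 - u (z.1 - h) z.2 := by
            rw [hUdef]; unfold Ubar; rw [indicator_of_mem hzs']; simp
          have hΨz' : Ψ (z - (h, 0)) = D.φ z.2 * PhiF m (D.V z.2) (u (z.1 - h) z.2) := by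
            rw [hΨ]; unfold Psi; rw [indicator_of_mem hzs']; simp
          have := mul_le_mul_of_nonneg_left (PhiF_conv hm (D.V z.2) (hun (z.1 - h) z.2) (hun z.1 z.2)) hcf
          rw [hUz, hUz', hΨz, hΨz']
          unfold P
          rw [hvz]
          linarith
        · have hzs' : z - (h, 0) ∉ slab N T := fun hc => by
            have := (mem_slab.1 hc).1
            simp at this; linarith
          have hUz' : U (z - (h, 0)) = 0 := indicator_of_notMem hzs' _
          have hΨz' : Ψ (z - (h, 0)) = 0 := indicator_of_notMem hzs' _
          have := mul_le_mul_of_nonneg_left (PhiF_conv hm (D.V z.2) (hu00 z.2) (hun z.1 z.2)) hcf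
          rw [PhiF_eq_zero hm (hu00 z.2) hz] at this
          rw [hUz, hUz', hΨz, hΨz']
          unfold P
          rw [hvz]
          linarith
      · have hΨz : Ψ z = 0 := indicator_of_notMem hzs _
        have := mul_nonneg (D.χ0 z.1) (hΨ0 (z - (h, 0)))
        simp only [hPs z hzs, hΨz]
        linarith
    rw [integral_sub I1 I2, integral_sub J2 J1, ← e1, ← e2] at s1
    refine le_trans ?_ s1
    rw [← integral_sub I1 (hχΨ h), ← mul_assoc, ← integral_const_mul]
    refine integral_mono ((hχΨ h).const_mul _) (I1.sub (hχΨ h)) fun z => ?_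
    simp only
    by_cases hzs : z ∈ slab N T
    · obtain ⟨b1, b2⟩ := mem_slab.1 hzs
      have := mul_le_mul_of_nonneg_right (hl z.1 b1 b2 h hh.le) (hΨ0 z)
      linarith
    · have hΨz : Ψ z = 0 := indicator_of_notMem hzs _
      simp [hΨz]
  refine le_of_forall_pos_le_add fun ε hε => ?_
  obtain ⟨δ, hδ, H⟩ := D.L5 T hT hUm hUb gb G hG hGe _ F hF hFd WE (C ^ m) v hvm hv0 hvM hw ε hε
  have hcont : Tendsto (fun h : ℝ => ∫ z : ℝ × EN N, D.χ (z.1 + h) * Ψ z) (𝓝[>] 0) (𝓝 (∫ z : ℝ × EN N, D.χ z.1 * Ψ z)) := by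
    refine tendsto_integral_filter_of_dominated_convergence (fun z => c * Ψ z) (Eventually.of_forall fun h => (hχΨ h).1)
      (Eventually.of_forall fun h => ae_of_all _ fun z => ?_) (hΨi.const_mul c) (ae_of_all _ fun z => ?_)
    · rw [Real.norm_of_nonneg (mul_nonneg (D.χ0 _) (hΨ0 z))]
      exact mul_le_mul_of_nonneg_right (h1 _) (hΨ0 z)
    · have : Continuous fun h : ℝ => D.χ (z.1 + h) * Ψ z := by fun_prop
      have := this.tendsto 0
      simp only [add_zero] at this
      exact this.mono_left nhdsWithin_le_nhds
  refine le_of_tendsto (hcont.const_mul l) ?_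
  filter_upwards [Ioo_mem_nhdsGT hδ] with h hh
  have a1 := key h hh.1
  have a2 := H h hh.1.le hh.2
  have a3 : h * (l * ∫ z : ℝ × EN N, D.χ (z.1 + h) * Ψ z) ≤ h * ((∫ z : ℝ × EN N, D.χ z.1 * dvg D.Wφ z.2 * D.Jv v z) + (∫ z : ℝ × EN N, dvg D.W z.2 * D.P v z)
        - (∫ z, F z * D.P v z) + ε) := by linarith
  have a4 := le_of_mul_le_mul_left a3 hh.1
  linarith
end TD

def gbar (N : ℕ) (T : ℝ) (g : ℝ → EN N → EN N) : ℝ × EN N → EN N :=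
  (slab N T).indicator fun z => g z.1 z.2

lemma hcs_ball {N : ℕ} {ζ : ℝ × EN N → ℝ} (hζ : HasCompactSupport ζ) :
    ∃ r : ℝ, 0 ≤ r ∧ ∀ z : ℝ × EN N, r < ‖z.2‖ → ζ z = 0 ∧ fderiv ℝ ζ z = 0 := by
  obtain ⟨r, hr⟩ := hζ.isCompact.isBounded.subset_closedBall 0
  refine ⟨max r 0, le_max_right _ _, fun z hz => ?_⟩
  have : z ∉ tsupport ζ := fun h => by
    have h1 := hr h
    have h2 : ‖z‖ ≤ r := by simpa using h1
    have h3 : ‖z.2‖ ≤ ‖z‖ := norm_snd_le z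
    have := le_max_left r 0
    linarith
  refine ⟨image_eq_zero_of_notMem_tsupport this, ?_⟩
  by_contra hne
  exact this (support_fderiv_subset ℝ hne)

lemma cyl_ind {N : ℕ} {F : Type*} [Zero F] (T r : ℝ) (f : ℝ × EN N → F) :
    (univ ×ˢ Metric.closedBall (0 : EN N) r).indicator ((slab N T).indicator f) =
      (Ioo 0 T ×ˢ Metric.closedBall (0 : EN N) r).indicator f := by
  rw [indicator_indicator]
  congr 1
  ext z; simp [slab]; tauto

lemma gbar_memLp {N : ℕ} {T : ℝ} {g : ℝ → EN N → EN N} (hg : Measurable (Function.uncurry g))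
    (h : ∀ K : Set (EN N), IsCompact K → ∫⁻ s in Ioo (0:ℝ) T, ∫⁻ x in K, ENNReal.ofReal (‖g s x‖ ^ 2) < ⊤) (r : ℝ) :
    MemLp ((univ ×ˢ Metric.closedBall (0 : EN N) r).indicator (gbar N T g)) 2 volume := by
  have hms : MeasurableSet (Ioo 0 T ×ˢ Metric.closedBall (0 : EN N) r) :=
    measurableSet_Ioo.prod Metric.isClosed_closedBall.measurableSet
  have hg' : Measurable fun z : ℝ × EN N => g z.1 z.2 := hg
  unfold gbar
  rw [cyl_ind, memLp_indicator_iff_restrict hms]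
  refine (memLp_two_iff_integrable_sq_norm hg'.aestronglyMeasurable).2 ?_
  refine ⟨(hg'.norm.pow_const 2).aestronglyMeasurable, ?_⟩
  rw [hasFiniteIntegral_iff_ofReal (ae_of_all _ fun z => by positivity), Measure.volume_eq_prod,
    ← Measure.prod_restrict, lintegral_prod _ ((hg'.norm.pow_const 2).ennreal_ofReal.aemeasurable)]
  exact h _ (isCompact_closedBall _ _)

lemma fbar_memLp {N : ℕ} {T q : ℝ} {w : EN N → ℝ} (hw : Continuous w) {u : ℝ → EN N → ℝ} (hu : Measurable (Function.uncurry u))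
    (hq : 0 ≤ q) {C : ℝ} (hun : ∀ t x, 0 ≤ u t x) (huC : ∀ t x, u t x ≤ C) (r : ℝ) :
    MemLp ((univ ×ˢ Metric.closedBall (0 : EN N) r).indicator (fbar N T q w u)) 2 volume := by
  have hms : MeasurableSet (Ioo 0 T ×ˢ Metric.closedBall (0 : EN N) r) :=
    measurableSet_Ioo.prod Metric.isClosed_closedBall.measurableSet
  have hfin : volume (Ioo 0 T ×ˢ Metric.closedBall (0 : EN N) r) ≠ ⊤ := by
    rw [Measure.volume_eq_prod, Measure.prod_prod]
    exact ENNReal.mul_ne_top (by simp) (isCompact_closedBall _ _).measure_lt_top.ne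
  obtain ⟨c, hc⟩ := (isCompact_closedBall (0 : EN N) r).exists_bound_of_continuousOn hw.continuousOn
  unfold fbar
  rw [cyl_ind]
  have hm1 : Measurable fun z : ℝ × EN N => w z.2 * u z.1 z.2 ^ q :=
    (hw.measurable.comp measurable_snd).mul (hu.pow_const q)
  refine MemLp.of_le (memLp_indicator_const 2 hms (max c 0 * C ^ q) (Or.inr hfin)) (hm1.indicator hms).aestronglyMeasurable
    (ae_of_all _ fun z => ?_)
  by_cases hz : z ∈ Ioo 0 T ×ˢ Metric.closedBall (0 : EN N) r
  · rw [indicator_of_mem hz, indicator_of_mem hz, norm_mul, norm_mul]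
    have a1 := (hc z.2 hz.2).trans (le_max_left c 0)
    have a2 : u z.1 z.2 ^ q ≤ C ^ q := Real.rpow_le_rpow (hun _ _) (huC _ _) hq
    have a3 : 0 ≤ u z.1 z.2 ^ q := Real.rpow_nonneg (hun _ _) _
    rw [Real.norm_of_nonneg a3, Real.norm_of_nonneg (le_max_right c 0), Real.norm_of_nonneg (a3.trans a2)]
    gcongr
  · simp [hz]

lemma slab_int {N : ℕ} {T : ℝ} {f : ℝ × EN N → ℝ} (hf : Integrable ((slab N T).indicator f)) :
    ∫ s in Ioo (0:ℝ) T, ∫ x, f (s, x) = ∫ z, (slab N T).indicator f z := by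
  rw [integral_indicator (slab_meas N T)]
  have := setIntegral_prod (μ := volume) (ν := volume) (s := Ioo 0 T) (t := univ) f
    ((integrable_indicator_iff (slab_meas N T)).1 hf)
  rw [Measure.volume_eq_prod]
  unfold slab
  rw [this]
  simp

lemma L2_ind {N : ℕ} {F : Type*} [NormedAddCommGroup F] {r : ℝ} {f : ℝ × EN N → F} {ζ : ℝ × EN N → ℝ}
    (hf : MemLp ((univ ×ˢ Metric.closedBall (0 : EN N) r).indicator f) 2 volume) (hfm : AEStronglyMeasurable f volume)
    (hζ : Continuous ζ) (hs : HasCompactSupport ζ) (h0 : ∀ z : ℝ × EN N, r < ‖z.2‖ → ζ z = 0) :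
    Integrable fun z => ‖f z‖ * ζ z := by
  have h1 : MemLp ζ 2 volume := hζ.memLp_of_hasCompactSupport hs
  have := hf.norm.integrable_mul h1
  refine this.congr (ae_of_all _ fun z => ?_)
  by_cases hz : r < ‖z.2‖
  · simp [h0 z hz]
  · have : z ∈ univ ×ˢ Metric.closedBall (0 : EN N) r := ⟨mem_univ _, by simpa using hz⟩
    simp only [Pi.mul_apply]
    rw [indicator_of_mem this]

lemma weak_eq {N : ℕ} {T q C : ℝ} {w : EN N → ℝ} (hw : Continuous w) {u0 : EN N → ℝ} {u : ℝ → EN N → ℝ} (hu0 : Measurable u0)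
    (hu : Measurable (Function.uncurry u)) (hq : 0 ≤ q)
    (hu00 : ∀ x, 0 ≤ u0 x) (hu0C : ∀ x, u0 x ≤ C) (hun : ∀ t x, 0 ≤ u t x) (huC : ∀ t x, u t x ≤ C)
    {g : ℝ → EN N → EN N} (hg : Measurable (Function.uncurry g))
    (h : ∀ K : Set (EN N), IsCompact K → ∫⁻ s in Ioo (0:ℝ) T, ∫⁻ x in K, ENNReal.ofReal (‖g s x‖ ^ 2) < ⊤)
    (ζ : ℝ × EN N → ℝ) (hζ : ContDiff ℝ 1 ζ) (hs : HasCompactSupport ζ)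
    (H : ∫ s in Ioo (0:ℝ) T, ∫ x,
            ((u0 x - u s x) * fderiv ℝ ζ (s, x) (1, 0)
              + fderiv ℝ ζ (s, x) (0, g s x)
              + w x * (u s x) ^ q * ζ (s, x)) = 0) :
    ∫ z, (Ubar N T u0 u z * fderiv ℝ ζ z (1, 0) + fderiv ℝ ζ z (0, gbar N T g z) + fbar N T q w u z * ζ z) = 0 := by
  obtain ⟨r, hr0, hr⟩ := hcs_ball hs
  have hζ' := hζ.continuous_fderiv one_ne_zero
  have hsupp' : HasCompactSupport (fun z => ‖fderiv ℝ ζ z‖) := (hs.fderiv (𝕜 := ℝ)).norm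
  have hgm : Measurable (gbar N T g) := hg.indicator (slab_meas N T)
  have hfm : Measurable (fbar N T q w u) :=
    ((hw.measurable.comp measurable_snd).mul (hu.pow_const q)).indicator (slab_meas N T)
  have I1 : Integrable fun z => Ubar N T u0 u z * fderiv ℝ ζ z (1, 0) := by
    have hUm : Measurable (Ubar N T u0 u) := ((hu0.comp measurable_snd).sub hu).indicator (slab_meas N T)
    have hUb : ∀ z, |Ubar N T u0 u z| ≤ C := by
      intro z
      unfold Ubar
      by_cases hz : z ∈ slab N T
      · rw [indicator_of_mem hz, abs_le]
        constructor <;> linarith [hu00 z.2, hu0C z.2, hun z.1 z.2, huC z.1 z.2]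
      · simpa [hz] using (hun 0 0).trans (huC 0 0)
    exact mul_int hUm hUb
      ((hζ'.clm_apply continuous_const).integrable_of_hasCompactSupport (hs.fderiv_apply ℝ _))
  have I2 : Integrable fun z => fderiv ℝ ζ z (0, gbar N T g z) := by
    have := L2_ind (gbar_memLp hg h r) hgm.aestronglyMeasurable hζ'.norm hsupp' (fun z hz => by rw [(hr z hz).2, norm_zero])
    refine this.mono' ?_ (ae_of_all _ fun z => ?_)
    · have hm2 : Measurable fun z => ((0:ℝ), gbar N T g z) := measurable_const.prodMk hgm
      have : Continuous fun p : (ℝ × EN N →L[ℝ] ℝ) × (ℝ × EN N) => p.1 p.2 := by fun_prop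
      exact (this.measurable.comp (hζ'.measurable.prodMk hm2)).aestronglyMeasurable
    · refine ((fderiv ℝ ζ z).le_opNorm _).trans (le_of_eq ?_)
      rw [mul_comm]
      simp [Prod.norm_def]
  have I3 : Integrable fun z => fbar N T q w u z * ζ z := by
    have := L2_ind (fbar_memLp (T := T) hw hu hq hun huC r) hfm.aestronglyMeasurable hζ.continuous.norm hs.norm (fun z hz => by rw [(hr z hz).1, norm_zero])
    refine this.mono' (hfm.aestronglyMeasurable.mul hζ.continuous.aestronglyMeasurable) (ae_of_all _ fun z => ?_)
    rw [norm_mul]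
  have e : (slab N T).indicator (fun z => (u0 z.2 - u z.1 z.2) * fderiv ℝ ζ z (1, 0)
              + fderiv ℝ ζ z (0, g z.1 z.2) + w z.2 * (u z.1 z.2) ^ q * ζ z) =
      fun z => Ubar N T u0 u z * fderiv ℝ ζ z (1, 0) + fderiv ℝ ζ z (0, gbar N T g z) + fbar N T q w u z * ζ z := by
    ext z
    unfold Ubar gbar fbar
    by_cases hz : z ∈ slab N T
    · simp only [indicator_of_mem hz]
    · have h0 : ((0:ℝ), (0 : EN N)) = 0 := rfl
      simp only [indicator_of_notMem hz, h0, map_zero]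
      simp
  rw [← e, ← slab_int]
  · exact H
  · rw [e]; exact (I1.add I2).add I3

def eta (T : ℝ) (k : ℕ) (t : ℝ) : ℝ := Real.smoothTransition (k * t) * Real.smoothTransition (k * (T - t))

lemma eta_contDiff (T : ℝ) (k : ℕ) : ContDiff ℝ 1 (eta T k) := by
  unfold eta
  exact ((Real.smoothTransition.contDiff).comp (contDiff_const.mul contDiff_id)).mul
    ((Real.smoothTransition.contDiff).comp (contDiff_const.mul (contDiff_const.sub contDiff_id)))

lemma eta_bd (T : ℝ) (k : ℕ) (t : ℝ) : |eta T k t| ≤ 1 := by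
  have a := Real.smoothTransition.nonneg (k * t)
  have b := Real.smoothTransition.nonneg (k * (T - t))
  unfold eta
  rw [abs_of_nonneg (mul_nonneg a b)]
  exact mul_le_one₀ (Real.smoothTransition.le_one _) b (Real.smoothTransition.le_one _)

lemma eta_out {T : ℝ} (k : ℕ) {t : ℝ} (h : t ∉ Ioo 0 T) : eta T k t = 0 := by
  unfold eta
  rw [mem_Ioo, not_and_or, not_lt, not_lt] at h
  have hk : (0:ℝ) ≤ k := k.cast_nonneg
  rcases h with h | h
  · rw [Real.smoothTransition.zero_of_nonpos (by nlinarith), zero_mul]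
  · rw [Real.smoothTransition.zero_of_nonpos (x := k * (T - t)) (by nlinarith), mul_zero]

lemma eta_lim {T t : ℝ} (h : t ∈ Ioo 0 T) : Tendsto (fun k => eta T k t) atTop (𝓝 1) := by
  refine tendsto_const_nhds.congr' ?_
  have h1 : Tendsto (fun k : ℕ => (k:ℝ) * t) atTop atTop := tendsto_natCast_atTop_atTop.atTop_mul_const h.1
  have h2 : Tendsto (fun k : ℕ => (k:ℝ) * (T - t)) atTop atTop := tendsto_natCast_atTop_atTop.atTop_mul_const (by linarith [h.2])
  filter_upwards [h1.eventually_ge_atTop 1, h2.eventually_ge_atTop 1] with k a b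
  unfold eta
  rw [Real.smoothTransition.one_of_one_le a, Real.smoothTransition.one_of_one_le b, one_mul]

lemma weak_grad {N : ℕ} {T m C : ℝ} (hm : 1 < m) {u : ℝ → EN N → ℝ}
    (hu : Measurable (Function.uncurry u)) (hun : ∀ t x, 0 ≤ u t x) (huC : ∀ t x, u t x ≤ C)
    {g : ℝ → EN N → EN N} (hg : Measurable (Function.uncurry g))
    (h : ∀ K : Set (EN N), IsCompact K → ∫⁻ s in Ioo (0:ℝ) T, ∫⁻ x in K, ENNReal.ofReal (‖g s x‖ ^ 2) < ⊤)
    (H : ∀ ζ : ℝ × EN N → ℝ, ContDiff ℝ 1 ζ →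
        HasCompactSupport ζ → (∀ s x, s ∉ Ioo (0:ℝ) T → ζ (s, x) = 0) →
        ∀ i : Fin N,
          (∫ s in Ioo (0:ℝ) T, ∫ x,
              (u s x) ^ m * fderiv ℝ ζ (s, x) (0, EuclideanSpace.single i 1))
            = - ∫ s in Ioo (0:ℝ) T, ∫ x, g s x i * ζ (s, x))
    (ζ : ℝ × EN N → ℝ) (hζ : ContDiff ℝ 1 ζ) (hs : HasCompactSupport ζ) (i : Fin N) :
    ∫ z, vbar N T m u z * fderiv ℝ ζ z (0, EuclideanSpace.single i 1) = - ∫ z, gbar N T g z i * ζ z := by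
  obtain ⟨r, hr0, hr⟩ := hcs_ball hs
  have hC : 0 ≤ C := (hun 0 0).trans (huC 0 0)
  have hζ' := hζ.continuous_fderiv one_ne_zero
  have hgm : Measurable (gbar N T g) := hg.indicator (slab_meas N T)
  have hgmi : Measurable fun z => gbar N T g z i :=
    ((EuclideanSpace.proj (𝕜 := ℝ) i : EN N →L[ℝ] ℝ).continuous.measurable).comp hgm
  have hvm : Measurable (vbar N T m u) := (hu.pow_const m).indicator (slab_meas N T)
  have hvb : ∀ z, |vbar N T m u z| ≤ C ^ m := fun z => by
    unfold vbar
    by_cases hz : z ∈ slab N T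
    · rw [indicator_of_mem hz, abs_of_nonneg (Real.rpow_nonneg (hun _ _) _)]
      exact Real.rpow_le_rpow (hun _ _) (huC _ _) (by linarith)
    · rw [indicator_of_notMem hz]; simp; positivity
  have I1 : Integrable fun z => vbar N T m u z * fderiv ℝ ζ z (0, EuclideanSpace.single i 1) :=
    mul_int hvm hvb ((hζ'.clm_apply continuous_const).integrable_of_hasCompactSupport (hs.fderiv_apply ℝ _))
  have I2 : Integrable fun z => gbar N T g z i * ζ z := by
    have := L2_ind (gbar_memLp hg h r) hgm.aestronglyMeasurable hζ.continuous.norm hs.norm (fun z hz => by rw [(hr z hz).1, norm_zero])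
    refine this.mono' (hgmi.aestronglyMeasurable.mul hζ.continuous.aestronglyMeasurable) (ae_of_all _ fun z => ?_)
    rw [norm_mul]
    gcongr
    exact PiLp.norm_apply_le _ _
  have ec : ∀ k, Continuous fun z : ℝ × EN N => eta T k z.1 := fun k => (eta_contDiff T k).continuous.comp continuous_fst
  have J1 : ∀ k, Integrable fun z => eta T k z.1 * (vbar N T m u z * fderiv ℝ ζ z (0, EuclideanSpace.single i 1)) := fun k =>
    I1.bdd_mul (c := 1) (ec k).aestronglyMeasurable (ae_of_all _ fun z => eta_bd T k z.1)
  have J2 : ∀ k, Integrable fun z => eta T k z.1 * (gbar N T g z i * ζ z) := fun k =>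
    I2.bdd_mul (c := 1) (ec k).aestronglyMeasurable (ae_of_all _ fun z => eta_bd T k z.1)
  have key : ∀ k, ∫ z, eta T k z.1 * (vbar N T m u z * fderiv ℝ ζ z (0, EuclideanSpace.single i 1)) =
      - ∫ z, eta T k z.1 * (gbar N T g z i * ζ z) := by
    intro k
    have hk : ContDiff ℝ 1 (fun z : ℝ × EN N => eta T k z.1 * ζ z) := ((eta_contDiff T k).comp contDiff_fst).mul hζ
    have hkd : ∀ z : ℝ × EN N, fderiv ℝ (fun z : ℝ × EN N => eta T k z.1 * ζ z) z (0, EuclideanSpace.single i 1) =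
        eta T k z.1 * fderiv ℝ ζ z (0, EuclideanSpace.single i 1) := by
      intro z
      have h1 : HasFDerivAt (fun z : ℝ × EN N => eta T k z.1) ((fderiv ℝ (eta T k) z.1).comp (ContinuousLinearMap.fst ℝ ℝ (EN N))) z :=
        (((eta_contDiff T k).differentiable one_ne_zero z.1).hasFDerivAt).comp z hasFDerivAt_fst
      have h3 : HasFDerivAt (fun z : ℝ × EN N => eta T k z.1 * ζ z) _ z := h1.mul (hζ.differentiable one_ne_zero z).hasFDerivAt
      rw [h3.fderiv]
      simp
    have := H _ hk hs.mul_left (fun s x hsx => by simp [eta_out k hsx]) i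
    have e1 : (slab N T).indicator (fun z => u z.1 z.2 ^ m * fderiv ℝ (fun z : ℝ × EN N => eta T k z.1 * ζ z) z (0, EuclideanSpace.single i 1)) =
        fun z => eta T k z.1 * (vbar N T m u z * fderiv ℝ ζ z (0, EuclideanSpace.single i 1)) := by
      ext z
      unfold vbar
      by_cases hz : z ∈ slab N T
      · simp only [indicator_of_mem hz, hkd]; ring
      · simp [hz]
    have e2 : (slab N T).indicator (fun z => g z.1 z.2 i * (eta T k z.1 * ζ z)) =
        fun z => eta T k z.1 * (gbar N T g z i * ζ z) := by
      ext z
      unfold gbar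
      by_cases hz : z ∈ slab N T
      · simp only [indicator_of_mem hz]; ring
      · simp [hz]
    rw [← e1, ← e2, ← slab_int (by rw [e1]; exact J1 k), ← slab_int (by rw [e2]; exact J2 k)]
    exact this
  have lim : ∀ f : ℝ × EN N → ℝ, Integrable f → (∀ z, z ∉ slab N T → f z = 0) →
      Tendsto (fun k => ∫ z, eta T k z.1 * f z) atTop (𝓝 (∫ z, f z)) := by
    intro f hf hf0
    refine tendsto_integral_of_dominated_convergence (fun z => ‖f z‖) (fun k => (ec k).aestronglyMeasurable.mul hf.1) hf.norm
      (fun k => ae_of_all _ fun z => ?_) (ae_of_all _ fun z => ?_)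
    · rw [norm_mul]
      exact mul_le_of_le_one_left (norm_nonneg _) (eta_bd T k z.1)
    · by_cases hz : z ∈ slab N T
      · have := (eta_lim hz.1).mul_const (f z)
        simpa using this
      · simp [hf0 z hz]
  refine tendsto_nhds_unique (lim _ I1 fun z hz => by unfold vbar; simp [hz]) ?_
  simp_rw [key]
  exact (lim _ I2 fun z hz => by unfold gbar; simp [hz]).neg

lemma seq_zero {G : ℕ → ℝ} {κ B b : ℝ} (hκ : 0 ≤ κ) (h1 : ∀ j, G j ≤ κ * G (j+1)) (hB : ∀ j, G j ≤ B * b ^ j)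
    (hb : 0 ≤ b) (hκb : κ * b < 1) (j : ℕ) : G j ≤ 0 := by
  have h2 : ∀ i, G j ≤ κ ^ i * G (j + i) := by
    intro i
    induction i with
    | zero => simp
    | succ i ih =>
      refine ih.trans ?_
      rw [pow_succ, mul_assoc]
      exact mul_le_mul_of_nonneg_left (h1 _) (by positivity)
  have h3 : ∀ i, G j ≤ B * b ^ j * (κ * b) ^ i := by
    intro i
    refine (h2 i).trans ((mul_le_mul_of_nonneg_left (hB _) (by positivity)).trans (le_of_eq ?_))
    rw [pow_add, mul_pow]; ring
  have h4 : Tendsto (fun i : ℕ => B * b ^ j * (κ * b) ^ i) atTop (𝓝 (B * b ^ j * 0)) :=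
    (tendsto_pow_atTop_nhds_zero_of_lt_one (by positivity) hκb).const_mul _
  rw [mul_zero] at h4
  exact ge_of_tendsto' h4 h3

lemma chi_exists {T : ℝ} (hT : 0 < T) (k : ℕ) :
    ∃ χ : ℝ → ℝ, ContDiff ℝ 1 χ ∧ (∀ t, 0 ≤ χ t) ∧ HasCompactSupport χ ∧ (∀ t, T ≤ t → χ t = 0) ∧
      (∀ t, 0 < t → t < T → 0 < χ t) ∧
      ∀ t, 0 < t → t < T → ∀ h, 0 ≤ h → h * (k / T) * χ (t + h) ≤ χ t - χ (t + h) := by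
  let b : ContDiffBump (0:ℝ) := ⟨T, T + 1, hT, by linarith⟩
  let K := k + 2
  let χ : ℝ → ℝ := fun t => b t * (max (T - t) 0) ^ K
  have hb : ∀ t, 0 < t → t < T → b t = 1 := fun t h1 h2 =>
    b.one_of_mem_closedBall (by simp only [Metric.mem_closedBall, dist_zero_right, Real.norm_eq_abs, abs_of_pos h1]; exact h2.le)
  have hz : ∀ t, T ≤ t → χ t = 0 := fun t ht => by
    simp only [χ, max_eq_right (by linarith : T - t ≤ 0)]
    simp [K]
  have hp : ∀ t, 0 < t → t < T → χ t = (T - t) ^ K := fun t h1 h2 => by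
    simp only [χ, hb t h1 h2, one_mul, max_eq_left (by linarith : 0 ≤ T - t)]
  have hcd : ContDiff ℝ 1 fun t : ℝ => (max (T - t) 0) ^ K :=
    (contDiff_pospow k).comp (contDiff_const.sub contDiff_id)
  have hpos : ∀ t, 0 ≤ χ t := fun t => mul_nonneg b.nonneg (by positivity)
  refine ⟨χ, b.contDiff.mul hcd, hpos,
    b.hasCompactSupport.mul_right, hz, fun t h1 h2 => ?_, fun t h1 h2 h h0 => ?_⟩
  · rw [hp t h1 h2]
    have : 0 < T - t := by linarith
    positivity
  · by_cases hth : T ≤ t + h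
    · rw [hz _ hth]
      simpa using hpos t
    · push Not at hth
      rw [hp t h1 h2, hp (t + h) (by linarith) hth]
      set β := T - (t + h) with hβ
      have hβ0 : 0 < β := by linarith
      have e : T - t = β * (1 + h / β) := by field_simp; rw [hβ]; ring
      have hx : 0 ≤ h / β := by positivity
      have B := one_add_mul_le_pow (a := h / β) (by linarith) K
      have B2 : h * (k / T) ≤ K * (h / β) := by
        have : (k:ℝ) / T ≤ K / β := by
          have : (k:ℝ) ≤ K := by simp [K]
          have : β ≤ T := by linarith
          gcongr
        calc h * (k / T) ≤ h * (K / β) := by gcongr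
          _ = _ := by ring
      rw [e, mul_pow]
      have hβK : 0 < β ^ K := by positivity
      nlinarith

lemma cutoff_exists (N : ℕ) : ∃ (φ : ℕ → EN N → ℝ) (Wφ : ℕ → EN N → EN N) (C1 : ℝ), 0 ≤ C1 ∧ ∀ j,
    ContDiff ℝ 1 (φ j) ∧ ContDiff ℝ 1 (Wφ j) ∧ (∀ x, 0 ≤ φ j x) ∧ (∀ x, φ j x ≤ 1) ∧
    (∀ x e, fderiv ℝ (φ j) x e = inner ℝ (Wφ j x) e) ∧
    (∀ x, 2 * 2 ^ j < ‖x‖ → φ j x = 0) ∧ (∀ x, 2 * 2 ^ j < ‖x‖ → Wφ j x = 0) ∧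
    (∀ x, ‖x‖ ≤ 2 ^ j → φ j x = 1) ∧ (∀ x, |dvg (Wφ j) x| ≤ C1 * φ (j+1) x) := by
  let ρ : ContDiffBump (0 : EN N) := ⟨1, 2, one_pos, one_lt_two⟩
  let Wρ : EN N → EN N := fun x => (InnerProductSpace.toDual ℝ (EN N)).symm (fderiv ℝ ρ x)
  have hρ : ContDiff ℝ 2 ρ := ρ.contDiff
  have hW : ContDiff ℝ 1 Wρ :=
    ((InnerProductSpace.toDual ℝ (EN N)).symm.toContinuousLinearEquiv.contDiff).comp (hρ.fderiv_right (m := 1) (by norm_num))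
  have hWi : ∀ x e, inner ℝ (Wρ x) e = fderiv ℝ ρ x e := fun x e => by
    simp [Wρ]
  have hcs : HasCompactSupport Wρ := by
    have := ρ.hasCompactSupport.fderiv (𝕜 := ℝ)
    exact this.comp_left (g := (InnerProductSpace.toDual ℝ (EN N)).symm) (map_zero _)
  have hz : ∀ x : EN N, 2 < ‖x‖ → x ∉ tsupport ρ := fun x hx h => by
    rw [ρ.tsupport_eq] at h
    have : ‖x‖ ≤ 2 := by simpa using h
    linarith
  have hz1 : ∀ x : EN N, 2 < ‖x‖ → ρ x = 0 := fun x hx => image_eq_zero_of_notMem_tsupport (hz x hx)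
  have hz2 : ∀ x : EN N, 2 < ‖x‖ → fderiv ℝ ρ x = 0 := fun x hx => by
    by_contra hne
    exact hz x hx (support_fderiv_subset ℝ hne)
  have hzW : ∀ x : EN N, 2 < ‖x‖ → Wρ x = 0 := fun x hx => by
    simp [Wρ, hz2 x hx]
  have hdz : ∀ x : EN N, 2 < ‖x‖ → dvg Wρ x = 0 := fun x hx => by
    have : Wρ =ᶠ[𝓝 x] fun _ => 0 := by
      filter_upwards [(isOpen_lt continuous_const continuous_norm).mem_nhds hx] with y hy using hzW y hy
    simp [dvg, this.fderiv_eq]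
  obtain ⟨C1, hC1⟩ := (isCompact_closedBall (0 : EN N) 2).exists_bound_of_continuousOn (continuous_dvg hW).continuousOn
  have hC1' : ∀ x, |dvg Wρ x| ≤ max C1 0 := fun x => by
    by_cases hx : 2 < ‖x‖
    · simp [hdz x hx]
    · exact (hC1 x (by simpa using hx)).trans (le_max_left _ _)
  let c : ℕ → ℝ := fun j => (2 ^ j)⁻¹
  have hc : ∀ j, 0 < c j := fun j => by positivity
  have hc1 : ∀ j, c j ≤ 1 := fun j => inv_le_one_of_one_le₀ (one_le_pow₀ one_le_two)
  have hcx : ∀ j (x : EN N), ‖c j • x‖ = ‖x‖ / 2 ^ j := fun j x => by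
    rw [norm_smul, Real.norm_of_nonneg (hc j).le]
    simp only [c]; field_simp
  have hfar : ∀ j (x : EN N), 2 * 2 ^ j < ‖x‖ → 2 < ‖c j • x‖ := fun j x hx => by
    rw [hcx, lt_div_iff₀ (by positivity)]; exact hx
  have hone : ∀ j (x : EN N), ‖x‖ ≤ 2 ^ j → ρ (c j • x) = 1 := fun j x hx => by
    refine ρ.one_of_mem_closedBall ?_
    rw [mem_closedBall_zero_iff, hcx, div_le_iff₀ (by positivity), one_mul]; exact hx
  have hd : ∀ j (x : EN N), HasFDerivAt (fun x : EN N => c j • x) (c j • ContinuousLinearMap.id ℝ (EN N)) x := fun j x =>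
    (hasFDerivAt_id x).const_smul (c j)
  refine ⟨fun j x => ρ (c j • x), fun j x => c j • Wρ (c j • x), max C1 0, le_max_right _ _, fun j =>
    ⟨?_, ?_, fun x => ρ.nonneg, fun x => ρ.le_one, fun x e => ?_, fun x hx => hz1 _ (hfar j x hx), fun x hx => ?_, hone j, fun x => ?_⟩⟩
  · exact ρ.contDiff.comp (contDiff_const_smul _)
  · exact (hW.comp (contDiff_const_smul _)).const_smul _
  · have h1 : HasFDerivAt (fun x : EN N => ρ (c j • x)) _ x :=
      HasFDerivAt.comp (g := (ρ : EN N → ℝ)) (f := fun x : EN N => c j • x) x ((hρ.differentiable two_ne_zero (c j • x)).hasFDerivAt) (hd j x)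
    rw [h1.fderiv]
    simp [inner_smul_left, hWi]
  · simp only [hzW _ (hfar j x hx), smul_zero]
  · have h1 : HasFDerivAt (fun x : EN N => c j • Wρ (c j • x)) _ x :=
      (HasFDerivAt.comp x ((hW.differentiable one_ne_zero (c j • x)).hasFDerivAt) (hd j x)).const_smul (c j)
    have h2 : dvg (fun x : EN N => c j • Wρ (c j • x)) x = c j * c j * dvg Wρ (c j • x) := by
      unfold dvg
      rw [h1.fderiv, Finset.mul_sum]
      refine Finset.sum_congr rfl fun i _ => ?_
      simp; ring
    rw [h2, abs_mul, abs_of_pos (mul_pos (hc j) (hc j))]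
    by_cases hx : 2 * 2 ^ j < ‖x‖
    · rw [hdz _ (hfar j x hx)]
      simp only [abs_zero, mul_zero]
      exact mul_nonneg (le_max_right _ _) ρ.nonneg
    · show _ ≤ max C1 0 * ρ (c (j+1) • x)
      rw [hone (j+1) x (by rw [pow_succ]; linarith), mul_one]
      calc c j * c j * |dvg Wρ (c j • x)| ≤ 1 * 1 * max C1 0 := by
            gcongr
            · exact hc1 j
            · exact hc1 j
            · exact hC1' _
        _ = _ := by ring

lemma cyl_vol {N : ℕ} {T : ℝ} (hT : 0 < T) (j : ℕ) (κ : ℝ) :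
    ∫ z, (Ioo 0 T ×ˢ Metric.closedBall (0 : EN N) (2 * 2 ^ j)).indicator (fun _ => κ) z =
      (T * 2 ^ N * volume.real (Metric.ball (0 : EN N) 1) * κ) * (2 ^ N) ^ j := by
  rw [integral_indicator (measurableSet_Ioo.prod Metric.isClosed_closedBall.measurableSet), setIntegral_const,
    Measure.volume_eq_prod, measureReal_prod_prod, Measure.addHaar_real_closedBall _ _ (by positivity)]
  simp only [Real.volume_real_Ioo_of_le hT.le, sub_zero, smul_eq_mul, finrank_euclideanSpace, Fintype.card_fin]
  rw [mul_pow, ← pow_mul, ← pow_mul, mul_comm j N]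
  ring

lemma comparison {N : ℕ} {m q : ℝ} (hm : 1 < m) (hq : 0 ≤ q) {w : EN N → ℝ} (hw : Continuous w)
    {u0 : EN N → ℝ} (hu0 : IsBddNonneg N u0) {u : ℝ → EN N → ℝ} (hu : IsWeakSolution N m q w u0 u)
    {V : EN N → ℝ} {W : EN N → EN N} (hV : ContDiff ℝ 1 V) (hW : ContDiff ℝ 1 W) (V0 : ∀ x, 0 ≤ V x)
    (Vd : ∀ x e, fderiv ℝ V x e = inner ℝ (W x) e)
    (hu0V : ∀ᵐ x, u0 x ^ m ≤ V x)
    (hH : ∀ᵐ z : ℝ × EN N, 0 < z.1 → V z.2 < u z.1 z.2 ^ m → dvg W z.2 ≤ w z.2 * u z.1 z.2 ^ q) :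
    ∀ᵐ z : ℝ × EN N, 0 < z.1 → u z.1 z.2 ^ m ≤ V z.2 := by
  obtain ⟨u0m, u00, ⟨Ca, hCa⟩⟩ := hu0
  obtain ⟨um, un, ⟨Cb, hCb⟩, g, hg, hsol⟩ := hu
  obtain ⟨φ, Wφ, C1, hC1, hφ⟩ := cutoff_exists N
  let C := max (max Ca Cb) 1
  have u0C : ∀ x, u0 x ≤ C := fun x => (hCa x).trans ((le_max_left _ _).trans (le_max_left _ _))
  have uC : ∀ t x, u t x ≤ C := fun t x => (hCb t x).trans ((le_max_right _ _).trans (le_max_left _ _))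
  have C0 : 0 < C := lt_of_lt_of_le one_pos (le_max_right _ _)
  set L := m * C ^ (m - 1) with hL
  have hL0 : 0 ≤ L := by positivity
  -- main claim
  have main : ∀ T : ℝ, 0 < T → ∀ j : ℕ, ∀ᵐ z : ℝ × EN N, z ∈ slab N T → ‖z.2‖ ≤ 2 ^ j → u z.1 z.2 ^ m ≤ V z.2 := by
    intro T hT
    obtain ⟨hloc, hgrad, heq⟩ := hsol T hT
    obtain ⟨k, hk⟩ := exists_nat_gt (T * (C1 * L * 2 ^ N))
    obtain ⟨χ, hχ, χ0, χc, χT, χpos, χl⟩ := chi_exists hT k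
    have hk0 : (0:ℝ) < k := lt_of_le_of_lt (by positivity) hk
    set l : ℝ := k / T with hl
    have hl0 : 0 < l := by positivity
    have hl1 : C1 * L * 2 ^ N < l := by rw [hl, lt_div_iff₀ hT]; linarith
    obtain ⟨M, hM⟩ := χc.exists_bound_of_continuous hχ.continuous
    have hM' : ∀ t, χ t ≤ M := fun t => (le_abs_self _).trans (hM t)
    have hM0 : 0 ≤ M := (χ0 0).trans (hM' 0)
    let Ψ : ℕ → ℝ × EN N → ℝ := fun j => Psi N T m (φ j) V u
    have hΨ0 : ∀ j z, 0 ≤ Ψ j z := fun j z => Psi_nonneg (hφ j).2.2.1 un z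
    have hΨi : ∀ j, Integrable (Ψ j) := fun j =>
      Psi_int hm (hφ j).1.continuous hV.continuous (hφ j).2.2.1 V0 um un uC (2 * 2 ^ j) 1 (hφ j).2.2.2.1 (hφ j).2.2.2.2.2.1
    have χcont : Continuous fun z : ℝ × EN N => χ z.1 := hχ.continuous.comp continuous_fst
    have hχΨ : ∀ j, Integrable fun z : ℝ × EN N => χ z.1 * Ψ j z := fun j =>
      (hΨi j).bdd_mul (c := M) χcont.aestronglyMeasurable (ae_of_all _ fun z => hM z.1)
    let G : ℕ → ℝ := fun j => ∫ z : ℝ × EN N, χ z.1 * Ψ j z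
    have hGB : ∀ j, G j ≤ (T * 2 ^ N * volume.real (Metric.ball (0 : EN N) 1) * (M * (1 * (C * (C ^ m) ^ 2)))) * (2 ^ N) ^ j := by
      intro j
      rw [← cyl_vol hT]
      have hm1 : MeasurableSet (Ioo 0 T ×ˢ Metric.closedBall (0 : EN N) (2 * 2 ^ j)) :=
        measurableSet_Ioo.prod Metric.isClosed_closedBall.measurableSet
      have hfin : volume (Ioo 0 T ×ˢ Metric.closedBall (0 : EN N) (2 * 2 ^ j)) ≠ ⊤ := by
        rw [Measure.volume_eq_prod, Measure.prod_prod]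
        exact ENNReal.mul_ne_top (by simp) (isCompact_closedBall _ _).measure_lt_top.ne
      refine integral_mono (hχΨ j) ((integrable_indicator_iff hm1).2 (integrableOn_const hfin)) fun z => ?_
      have h1 := Psi_le (T := T) hm (hφ j).2.2.1 V0 un uC (2 * 2 ^ j) 1 (hφ j).2.2.2.1 (hφ j).2.2.2.2.2.1 z
      calc χ z.1 * Ψ j z ≤ M * _ := mul_le_mul (hM' _) h1 (hΨ0 j z) hM0
        _ = _ := by
          by_cases hz : z ∈ Ioo 0 T ×ˢ Metric.closedBall (0 : EN N) (2 * 2 ^ j)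
          · rw [indicator_of_mem hz, indicator_of_mem hz]
          · rw [indicator_of_notMem hz, indicator_of_notMem hz, mul_zero]
    have hstep : ∀ j, l * G j ≤ (C1 * L) * G (j+1) := by
      intro j
      let D : TD N := ⟨χ, hχ, χ0, χc, φ j, Wφ j, (hφ j).1, (hφ j).2.1, (hφ j).2.2.1, (hφ j).2.2.2.2.1, 2 * 2 ^ j,
        (hφ j).2.2.2.2.2.1, (hφ j).2.2.2.2.2.2.1, V, W, hV, hW, V0, Vd⟩
      have key := D.L6 T χT hm (q := q) (w := w) u0m um u00 u0C un uC (gbar N T g) _ (gbar_memLp hg hloc (D.r + 1)) rfl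
        ((univ ×ˢ Metric.closedBall (0 : EN N) D.r).indicator (fbar N T q w u)) (fbar_memLp hw um hq un uC D.r)
        (fun z hz => by rw [indicator_of_mem]; exact ⟨mem_univ _, by simpa using hz⟩)
        (fun ζ h1 h2 h3 => weak_eq hw u0m um hq u00 u0C un uC hg hloc ζ h1 h2 (heq ζ h1 h2 fun s x hs => h3 (s, x) hs))
        (fun ζ h1 h2 i => weak_grad hm um un uC hg hloc hgrad ζ h1 h2 i) l χl hu0V hH
      refine key.trans ?_
      show _ ≤ (C1 * L) * ∫ z : ℝ × EN N, χ z.1 * Ψ (j+1) z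
      rw [← integral_const_mul]
      have hle : ∀ z : ℝ × EN N, |χ z.1 * dvg D.Wφ z.2 * D.Jv (vbar N T m u) z| ≤ C1 * L * (χ z.1 * Ψ (j+1) z) := by
        intro z
        have hd := (hφ j).2.2.2.2.2.2.2.2 z.2
        have hφ1 := (hφ (j+1)).2.2.1 z.2
        by_cases hz : z ∈ slab N T
        · have e1 : vbar N T m u z = u z.1 z.2 ^ m := indicator_of_mem hz _
          have e2 : Ψ (j+1) z = φ (j+1) z.2 * PhiF m (V z.2) (u z.1 z.2) := indicator_of_mem hz _
          have hJ : D.Jv (vbar N T m u) z ≤ L * PhiF m (V z.2) (u z.1 z.2) := by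
            unfold TD.Jv
            rw [e1]
            exact J_le_Phi hm (un z.1 z.2) (uC z.1 z.2) (V0 z.2)
          have hJ0 : 0 ≤ D.Jv (vbar N T m u) z := by unfold TD.Jv; positivity
          rw [abs_mul, abs_mul, abs_of_nonneg (χ0 _), abs_of_nonneg hJ0, e2]
          have hc := χ0 z.1
          calc χ z.1 * |dvg D.Wφ z.2| * D.Jv (vbar N T m u) z
              ≤ χ z.1 * (C1 * φ (j+1) z.2) * (L * PhiF m (V z.2) (u z.1 z.2)) := by
                refine mul_le_mul (mul_le_mul_of_nonneg_left hd hc) hJ hJ0 (by positivity)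
            _ = _ := by ring
        · have e1 : vbar N T m u z = 0 := indicator_of_notMem hz _
          have hJ : D.Jv (vbar N T m u) z = 0 := by
            unfold TD.Jv
            rw [e1, max_eq_right (by have : 0 ≤ D.V z.2 := V0 z.2
                                     linarith)]
            simp
          rw [hJ, mul_zero, abs_zero]
          have := hΨ0 (j+1) z
          have := χ0 z.1
          positivity
      have hint : Integrable fun z : ℝ × EN N => C1 * L * (χ z.1 * Ψ (j+1) z) := (hχΨ (j+1)).const_mul _
      have hm2 : AEStronglyMeasurable (fun z : ℝ × EN N => χ z.1 * dvg D.Wφ z.2 * D.Jv (vbar N T m u) z) volume := by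
        have hvm : Measurable (vbar N T m u) := (um.pow_const m).indicator (slab_meas N T)
        have hVm : Measurable fun z : ℝ × EN N => D.V z.2 := hV.continuous.measurable.comp measurable_snd
        have hJm : Measurable (D.Jv (vbar N T m u)) := by
          unfold TD.Jv
          exact (((hvm.sub hVm).max measurable_const).pow_const 3).div_const 3
        have hdm : Measurable fun z : ℝ × EN N => dvg D.Wφ z.2 := (continuous_dvg D.hWφ).measurable.comp measurable_snd
        exact ((χcont.measurable.mul hdm).mul hJm).aestronglyMeasurable
      exact integral_mono (hint.mono' hm2 (ae_of_all _ hle)) hint fun z => (le_abs_self _).trans (hle z)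
    have hG : ∀ j, G j ≤ 0 := fun j => by
      refine seq_zero (κ := C1 * L / l) (b := 2 ^ N) (by positivity) (fun j => ?_) hGB (by positivity) ?_ j
      · rw [div_mul_eq_mul_div, le_div_iff₀ hl0]
        linarith [hstep j]
      · rw [div_mul_eq_mul_div, div_lt_one hl0]; exact hl1
    intro j
    have hz0 : (fun z : ℝ × EN N => χ z.1 * Ψ j z) =ᵐ[volume] 0 := by
      refine (integral_eq_zero_iff_of_nonneg (fun z => mul_nonneg (χ0 _) (hΨ0 j z)) (hχΨ j)).1 ?_
      exact le_antisymm (hG j) (integral_nonneg fun z => mul_nonneg (χ0 _) (hΨ0 j z))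
    filter_upwards [hz0] with z hz hs hb
    have h1 := χpos z.1 (mem_slab.1 hs).1 (mem_slab.1 hs).2
    have h2 : Ψ j z = 0 := by
      rcases mul_eq_zero.1 hz with h | h
      · exact absurd h h1.ne'
      · exact h
    have h3 : PhiF m (V z.2) (u z.1 z.2) = 0 := by
      have : Ψ j z = φ j z.2 * PhiF m (V z.2) (u z.1 z.2) := indicator_of_mem hs _
      rwa [this, (hφ j).2.2.2.2.2.2.2.1 _ hb, one_mul] at h2
    have h4 := J_le_Phi hm (un z.1 z.2) (uC z.1 z.2) (V0 z.2)
    rw [h3, mul_zero] at h4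
    by_contra! hlt
    have : 0 < max (u z.1 z.2 ^ m - V z.2) 0 := lt_max_of_lt_left (by linarith)
    have : 0 < (max (u z.1 z.2 ^ m - V z.2) 0) ^ 3 / 3 := by positivity
    linarith
  have main2 : ∀ᵐ z : ℝ × EN N, ∀ n j : ℕ, z ∈ slab N (n + 1) → ‖z.2‖ ≤ 2 ^ j → u z.1 z.2 ^ m ≤ V z.2 := by
    rw [ae_all_iff]; intro n
    rw [ae_all_iff]; intro j
    exact main (n + 1) (by positivity) j
  filter_upwards [main2] with z hz h0
  obtain ⟨n, hn⟩ := exists_nat_gt z.1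
  obtain ⟨j, hj⟩ := pow_unbounded_of_one_lt ‖z.2‖ (one_lt_two : (1:ℝ) < 2)
  exact hz n j (mem_slab.2 ⟨h0, by linarith⟩) hj.le

def DWp (N : ℕ) (p : ℝ) (x : EN N) : EN N →L[ℝ] EN N :=
  ‖x‖ ^ p • ContinuousLinearMap.id ℝ (EN N) + (p * ‖x‖ ^ (p - 2)) • (innerSL ℝ x).smulRight x

lemma DWp_zero {N : ℕ} {p : ℝ} (hp : 0 < p) : DWp N p (0 : EN N) = 0 := by
  refine ContinuousLinearMap.ext fun v => ?_
  show ‖(0 : EN N)‖ ^ p • v + (p * ‖(0 : EN N)‖ ^ (p - 2)) • (inner ℝ (0 : EN N) v • (0 : EN N)) = 0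
  rw [norm_zero, Real.zero_rpow hp.ne', zero_smul, smul_zero, smul_zero, add_zero]

lemma DWp_bound {N : ℕ} {p : ℝ} (hp : 0 < p) (x : EN N) : ‖DWp N p x‖ ≤ (1 + p) * ‖x‖ ^ p := by
  by_cases hx : x = 0
  · subst hx
    rw [DWp_zero hp]; simp [Real.zero_rpow hp.ne']
  · have hx0 : 0 < ‖x‖ := norm_pos_iff.2 hx
    refine (norm_add_le _ _).trans ?_
    rw [norm_smul, norm_smul, ContinuousLinearMap.norm_smulRight_apply, innerSL_apply_norm,
      Real.norm_of_nonneg (by positivity), Real.norm_of_nonneg (by positivity)]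
    have e : ‖x‖ ^ (p - 2) * (‖x‖ * ‖x‖) = ‖x‖ ^ p := by
      rw [← sq, ← Real.rpow_natCast, ← Real.rpow_add hx0]; norm_num
    have h1 : ‖ContinuousLinearMap.id ℝ (EN N)‖ ≤ 1 := ContinuousLinearMap.norm_id_le
    have h2 : ‖x‖ ^ p * ‖ContinuousLinearMap.id ℝ (EN N)‖ ≤ ‖x‖ ^ p * 1 := by gcongr
    calc _ ≤ ‖x‖ ^ p * 1 + p * (‖x‖ ^ (p - 2) * (‖x‖ * ‖x‖)) := by linarith
      _ = _ := by rw [e]; ring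

lemma Wp_deriv {N : ℕ} {p : ℝ} (hp : 0 < p) (x : EN N) :
    HasFDerivAt (fun x : EN N => ‖x‖ ^ p • x) (DWp N p x) x := by
  by_cases hx : x = 0
  · subst hx
    have e : DWp N p (0 : EN N) = 0 := DWp_zero hp
    rw [e, hasFDerivAt_iff_isLittleO_nhds_zero]
    simp only [zero_add, smul_zero, sub_zero, zero_apply]
    rw [Asymptotics.isLittleO_iff]
    intro c hc
    have ht : Tendsto (fun h : EN N => ‖h‖ ^ p) (𝓝 0) (𝓝 0) := by
      have : Continuous fun h : EN N => ‖h‖ ^ p := continuous_norm.rpow_const fun _ => Or.inr hp.le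
      have h2 := this.tendsto 0
      simpa [Real.zero_rpow hp.ne'] using h2
    filter_upwards [ht.eventually (gt_mem_nhds hc)] with h hh
    rw [norm_smul, Real.norm_of_nonneg (by positivity)]
    gcongr
  · have hx0 : 0 < ‖x‖ := norm_pos_iff.2 hx
    have h1 : HasFDerivAt (fun x : EN N => (‖x‖ ^ 2) ^ (p / 2)) (((p / 2) * (‖x‖ ^ 2) ^ (p / 2 - 1)) • (2 • innerSL ℝ x)) x :=
      (hasStrictFDerivAt_norm_sq x).hasFDerivAt.rpow_const (Or.inl (by positivity))
    have e : (fun x : EN N => (‖x‖ ^ 2) ^ (p / 2)) = fun x => ‖x‖ ^ p := by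
      ext y
      rw [← Real.rpow_natCast, ← Real.rpow_mul (norm_nonneg _)]
      congr 1; push_cast; ring
    have e2 : (‖x‖ ^ 2) ^ (p / 2 - 1) = ‖x‖ ^ (p - 2) := by
      rw [← Real.rpow_natCast, ← Real.rpow_mul (norm_nonneg _)]
      congr 1; push_cast; ring
    rw [e, e2] at h1
    have h2 := h1.smul (hasFDerivAt_id x)
    refine h2.congr_fderiv ?_
    ext1 v
    simp [DWp, smul_smul]
    congr 1
    ring

lemma Wp_contDiff {N : ℕ} {p : ℝ} (hp : 0 < p) : ContDiff ℝ 1 (fun x : EN N => ‖x‖ ^ p • x) := by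
  rw [contDiff_one_iff_fderiv]
  refine ⟨fun x => (Wp_deriv hp x).differentiableAt, ?_⟩
  have e : fderiv ℝ (fun x : EN N => ‖x‖ ^ p • x) = DWp N p := by ext1 x; exact (Wp_deriv hp x).fderiv
  rw [e, continuous_iff_continuousAt]
  have hc : Continuous fun h : EN N => ‖h‖ ^ p := continuous_norm.rpow_const fun _ => Or.inr hp.le
  intro x
  by_cases hx : x = 0
  · subst hx
    have e : DWp N p (0 : EN N) = 0 := DWp_zero hp
    unfold ContinuousAt
    rw [e]
    refine squeeze_zero_norm (DWp_bound hp) ?_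
    have := (hc.const_mul (1 + p)).tendsto 0
    simpa [Real.zero_rpow hp.ne'] using this
  · have hx0 : ‖x‖ ≠ 0 := norm_ne_zero_iff.2 hx
    have h1 : ContinuousAt (fun h : EN N => ‖h‖ ^ (p - 2)) x := continuous_norm.continuousAt.rpow_const (Or.inl hx0)
    have h2 : Continuous fun x : EN N => (innerSL ℝ x).smulRight x := by fun_prop
    unfold DWp
    exact (hc.continuousAt.smul continuousAt_const).add ((h1.const_mul p).smul h2.continuousAt)

lemma Wp_dvg {N : ℕ} {p : ℝ} (hp : 0 < p) (k : ℝ) (x : EN N) :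
    dvg (fun x : EN N => k • (‖x‖ ^ p • x)) x = k * ((N + p) * ‖x‖ ^ p) := by
  unfold dvg
  have h1 := (Wp_deriv hp x).const_smul k
  have h1' : HasFDerivAt (fun x : EN N => k • (‖x‖ ^ p • x)) (k • DWp N p x) x := h1
  rw [h1'.fderiv]
  have e0 : ∀ i : Fin N, ((k • DWp N p x) (EuclideanSpace.single i 1)) i = k * (‖x‖ ^ p + p * ‖x‖ ^ (p - 2) * (x i) ^ 2) := by
    intro i
    have h3 : inner ℝ x (EuclideanSpace.single i 1) = x i := by
      rw [EuclideanSpace.inner_single_right]; simp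
    have h4 : (k • DWp N p x) (EuclideanSpace.single i 1) = k • (‖x‖ ^ p • EuclideanSpace.single i 1 +
      (p * ‖x‖ ^ (p - 2)) • (inner ℝ x (EuclideanSpace.single i 1) • x)) := rfl
    rw [h4, h3]
    simp
    ring_nf
  simp_rw [e0]
  rw [← Finset.mul_sum, Finset.sum_add_distrib, ← Finset.mul_sum, ← EuclideanSpace.real_norm_sq_eq]
  simp only [Finset.sum_const, Finset.card_univ, Fintype.card_fin, nsmul_eq_mul]
  by_cases hx : x = 0
  · subst hx; simp [Real.zero_rpow hp.ne']
  · have hx0 : 0 < ‖x‖ := norm_pos_iff.2 hx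
    have e : ‖x‖ ^ (p - 2) * ‖x‖ ^ 2 = ‖x‖ ^ p := by
      rw [← Real.rpow_natCast, ← Real.rpow_add hx0]; norm_num
    rw [mul_assoc, e]; ring

/-- **Comparison with the stationary supersolution on `B(0,R)`.**
Under the hypotheses of Theorem 1.3 (`σ ≥ σ*`, `a > σ/(1−q)`, the smallness condition
on `A, R`, `u₀ ≤ A|x|^a` a.e. on `B(0,R)` and `‖u₀‖_∞ ≤ A R^a`), every non-negative
weak solution `u` of `∂ₜ u = Δ(uᵐ) − |x|^σ u^q` with `u(0) = u₀` satisfies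
`u(t,x) ≤ A|x|^a` for a.e. `(t,x) ∈ (0,∞)×B(0,R)`. -/
theorem supersolution_bound_on_ball
    (N : ℕ) (hN : 1 ≤ N) (m q σ : ℝ) (hm : 1 < m) (hq0 : 0 < q) (hq1 : q < 1)
    (hσ : 2 * (1 - q) / (m - 1) ≤ σ)
    (a A R : ℝ) (ha0 : 0 < a) (hA0 : 0 < A) (hR0 : 0 < R)
    (ha : σ / (1 - q) < a)
    (hAR : A ^ (m - q) * R ^ (a * (m - q) - σ - 2) ≤ 1 / (a * m * (a * m + N - 2)))
    (u0 : EuclideanSpace ℝ (Fin N) → ℝ) (hu0 : IsBddNonneg N u0)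
    (hu0loc : ∀ᵐ x : EuclideanSpace ℝ (Fin N), ‖x‖ < R → u0 x ≤ A * ‖x‖ ^ a)
    (hu0sup : ∀ᵐ x : EuclideanSpace ℝ (Fin N), u0 x ≤ A * R ^ a)
    (u : ℝ → EuclideanSpace ℝ (Fin N) → ℝ)
    (hu : IsWeakSolution N m q (fun x => ‖x‖ ^ σ) u0 u) :
    ∀ᵐ p : ℝ × EuclideanSpace ℝ (Fin N),
      0 < p.1 → ‖p.2‖ < R → u p.1 p.2 ≤ A * ‖p.2‖ ^ a := by
  have hm0 : 0 < m := by linarith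
  have h1q : 0 < 1 - q := by linarith
  have hm1 : 0 < m - 1 := by linarith
  have hσ0 : 0 < σ := lt_of_lt_of_le (by positivity) hσ
  have hσ2 : 2 * (1 - q) ≤ σ * (m - 1) := (div_le_iff₀ hm1).1 hσ
  have ha2 : σ < a * (1 - q) := (div_lt_iff₀ h1q).1 ha
  have ham : 2 < a * (m - 1) := by
    have : 2 * (1 - q) < a * (m - 1) * (1 - q) := by nlinarith
    exact lt_of_mul_lt_mul_right this h1q.le
  have hexp : 0 < a * (m - q) - σ - 2 := by nlinarith
  have ham2 : 0 < a * m - 2 := by nlinarith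
  have hNr : (1:ℝ) ≤ N := by exact_mod_cast hN
  have un := hu.2.1
  have u00 := hu0.2.1
  have hw : Continuous fun x : EN N => ‖x‖ ^ σ := continuous_norm.rpow_const fun _ => Or.inr hσ0.le
  have pw : ∀ x : EN N, (A * ‖x‖ ^ a) ^ m = A ^ m * ‖x‖ ^ (a * m) := fun x => by
    rw [Real.mul_rpow hA0.le (by positivity), ← Real.rpow_mul (norm_nonneg _)]
  -- step 1
  have S1 := comparison hm hq0.le hw hu0 hu (V := fun _ => (A * R ^ a) ^ m) (W := fun _ => 0)
    contDiff_const contDiff_const (fun _ => by positivity) (fun x e => by simp)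
    (by
      filter_upwards [hu0sup] with x hx
      exact Real.rpow_le_rpow (u00 x) hx hm0.le)
    (ae_of_all _ fun z _ _ => by
      have h1 : 0 ≤ ‖z.2‖ ^ σ * u z.1 z.2 ^ q := mul_nonneg (by positivity) (Real.rpow_nonneg (un _ _) _)
      simpa [dvg] using h1)
  -- step 2
  have S2 := comparison hm hq0.le hw hu0 hu (V := fun x => A ^ m * ‖x‖ ^ (a * m))
    (W := fun x => (A ^ m * (a * m)) • (‖x‖ ^ (a * m - 2) • x))
    (contDiff_const.mul (contDiff_norm_rpow (by linarith)))
    ((Wp_contDiff ham2).const_smul _) (fun _ => by positivity)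
    (fun x e => by
      have h1 : HasFDerivAt (fun x : EN N => A ^ m * ‖x‖ ^ (a * m)) _ x :=
        (hasFDerivAt_norm_rpow x (by linarith : 1 < a * m)).const_mul (A ^ m)
      rw [h1.fderiv]
      simp [inner_smul_left]
      ring)
    (by
      filter_upwards [hu0sup, hu0loc] with x h1 h2
      rw [← pw]
      refine Real.rpow_le_rpow (u00 x) ?_ hm0.le
      by_cases hx : ‖x‖ < R
      · exact h2 hx
      · push Not at hx
        refine h1.trans ?_
        gcongr)
    (by
      filter_upwards [S1] with z h1 hz h2
      have h1 := h1 hz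
      rw [← pw] at h2
      have hxR : ‖z.2‖ < R := by
        have h3 := lt_of_lt_of_le h2 h1
        have h4 := (Real.rpow_lt_rpow_iff (by positivity) (by positivity) hm0).1 h3
        have h5 := lt_of_mul_lt_mul_left h4 hA0.le
        exact (Real.rpow_lt_rpow_iff (norm_nonneg _) hR0.le ha0).1 h5
      have hu1 : A * ‖z.2‖ ^ a < u z.1 z.2 := (Real.rpow_lt_rpow_iff (by positivity) (un _ _) hm0).1 h2
      rw [Wp_dvg ham2]
      set ξ := ‖z.2‖ with hξ
      have hξ0 : 0 ≤ ξ := norm_nonneg _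
      have hk : 0 < a * m * (a * m + N - 2) := by
        have : 0 < a * m + N - 2 := by linarith
        positivity
      have huq : (A * ξ ^ a) ^ q ≤ u z.1 z.2 ^ q := Real.rpow_le_rpow (by positivity) hu1.le hq0.le
      refine le_trans ?_ (mul_le_mul_of_nonneg_left huq (by positivity : 0 ≤ ξ ^ σ))
      rcases hξ0.eq_or_lt with h0 | h0
      · rw [← h0, Real.zero_rpow ham2.ne', Real.zero_rpow hσ0.ne']; simp
      have hs : A ^ (m - q) * ξ ^ (a * (m - q) - σ - 2) * (a * m * (a * m + N - 2)) ≤ 1 := by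
        rw [← le_div_iff₀ hk]
        refine le_trans ?_ hAR
        gcongr
      have eA : A ^ m = A ^ (m - q) * A ^ q := by rw [← Real.rpow_add hA0]; congr 1; ring
      have eξ : ξ ^ (a * m - 2) = ξ ^ (a * (m - q) - σ - 2) * (ξ ^ σ * ξ ^ (a * q)) := by
        rw [← Real.rpow_add h0, ← Real.rpow_add h0]; congr 1; ring
      rw [Real.mul_rpow hA0.le (by positivity), ← Real.rpow_mul hξ0, eA, eξ]
      calc _ = (A ^ (m - q) * ξ ^ (a * (m - q) - σ - 2) * (a * m * (a * m + N - 2))) * (ξ ^ σ * (A ^ q * ξ ^ (a * q))) := by ring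
        _ ≤ 1 * (ξ ^ σ * (A ^ q * ξ ^ (a * q))) := mul_le_mul_of_nonneg_right hs (by positivity)
        _ = _ := one_mul _)
  filter_upwards [S2] with z hz h0 _
  have := hz h0
  rw [← pw] at this
  exact (Real.rpow_le_rpow_iff (un _ _) (by positivity) hm0).1 this
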